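/- arXiv:2409.08559 — 2 statements merged into one kernel-verified Lean document; each statement's English description precedes it below -/
import Mathlib

section
/- Let F_q be a finite field with q elements and ω₁(f) the number of monic irreducible factors of f with multiplicity exactly 1. As n → ∞, Σ_{f ∈ M_n} (ω₁(f) - log n)² = q^n log n + c₃ q^n + O(q^n (log n)/n), where c₃ = (A₁ - 2L(2))(A₁ + 1) - π²/6 + L(2)² + 2L(3) - L(4). -/
open Filter Asymptotics Real Polynomial

/-- number of monic irreducible polynomials of degree r in F[t] -/
noncomputable def piq (F : Type*) [Field F] [Fintype F] (r : ℕ) : ℕ :=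
  Nat.card {l : Polynomial F // l.Monic ∧ Irreducible l ∧ l.natDegree = r}

/-- the constant A₁ = γ + Σ_{r≥1} (π_q(r) - q^r/r) q^{-r} -/
noncomputable def A1 (F : Type*) [Field F] [Fintype F] : ℝ :=
  Real.eulerMascheroniConstant +
    ∑' r : ℕ, if r = 0 then 0 else
      ((piq F r : ℝ) - (Fintype.card F : ℝ) ^ r / r) * ((Fintype.card F : ℝ) ^ r)⁻¹

/-- L(m) = Σ_{l ∈ P} |l|^{-m} -/
noncomputable def Lc (F : Type*) [Field F] [Fintype F] (m : ℕ) : ℝ :=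
  ∑' l : {l : Polynomial F // l.Monic ∧ Irreducible l},
    (((Fintype.card F : ℝ) ^ (l : Polynomial F).natDegree) ^ m)⁻¹

/-- ω_k(f): the number of distinct monic irreducible factors of f with multiplicity exactly k -/
noncomputable def omegak (F : Type*) [Field F] [Fintype F] (k : ℕ) (f : Polynomial F) : ℕ :=
  Nat.card {l : Polynomial F // l.Monic ∧ Irreducible l ∧ l ^ k ∣ f ∧ ¬ l ^ (k + 1) ∣ f}
section Counting

variable (F : Type*) [Field F] [Fintype F]

lemma vo_finite_monic (n : ℕ) : {f : F[X] | f.Monic ∧ f.natDegree = n}.Finite := by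
  have : Finite {p : F[X] // p.Monic ∧ p.natDegree = n} :=
    Finite.of_equiv _ ((monicEquivDegreeLT (R := F) n).trans (degreeLTEquiv F n).toEquiv).symm
  exact Set.finite_coe_iff.1 this

lemma vo_card_monic (n : ℕ) :
    Nat.card {p : F[X] // p.Monic ∧ p.natDegree = n} = Fintype.card F ^ n := by
  rw [Nat.card_congr ((monicEquivDegreeLT (R := F) n).trans (degreeLTEquiv F n).toEquiv)]
  simp

/-- monic polynomials of degree n -/
noncomputable def voM (n : ℕ) : Finset F[X] := (vo_finite_monic F n).toFinset

variable {F} in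
lemma vo_mem_M {n : ℕ} {f : F[X]} : f ∈ voM F n ↔ f.Monic ∧ f.natDegree = n := by
  simp [voM]

lemma vo_card_M (n : ℕ) : (voM F n).card = Fintype.card F ^ n := by
  rw [← vo_card_monic F n, ← Nat.card_eq_finsetCard]
  exact Nat.card_congr (Equiv.subtypeEquivRight fun x => vo_mem_M)

open Classical in
lemma vo_count_dvd (n : ℕ) (g : F[X]) (hg : g.Monic) :
    ((voM F n).filter (fun f => g ∣ f)).card =
      if g.natDegree ≤ n then Fintype.card F ^ (n - g.natDegree) else 0 := by
  split_ifs with h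
  · rw [← vo_card_M F (n - g.natDegree)]
    symm
    refine Finset.card_bij (fun a _ => g * a) ?_ ?_ ?_
    · intro a ha
      rw [vo_mem_M] at ha
      rw [Finset.mem_filter, vo_mem_M]
      refine ⟨⟨hg.mul ha.1, ?_⟩, dvd_mul_right _ _⟩
      rw [hg.natDegree_mul ha.1, ha.2]; omega
    · intro a _ b _ hab
      exact mul_left_cancel₀ hg.ne_zero hab
    · intro b hb
      rw [Finset.mem_filter, vo_mem_M] at hb
      obtain ⟨⟨hb1, hb2⟩, c, rfl⟩ := hb
      have hc : c.Monic := hg.of_mul_monic_left hb1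
      refine ⟨c, ?_, rfl⟩
      rw [vo_mem_M]
      rw [hg.natDegree_mul hc] at hb2
      exact ⟨hc, by omega⟩
  · rw [Finset.card_eq_zero, Finset.filter_eq_empty_iff]
    intro f hf hd
    rw [vo_mem_M] at hf
    exact h (hf.2 ▸ natDegree_le_of_dvd hd hf.1.ne_zero)

/-- monic irreducibles of degree r -/
noncomputable def voI (r : ℕ) : Finset F[X] := by
  classical exact (voM F r).filter Irreducible

variable {F} in
lemma vo_mem_I {n : ℕ} {f : F[X]} : f ∈ voI F n ↔ f.Monic ∧ Irreducible f ∧ f.natDegree = n := by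
  simp [voI, vo_mem_M]; tauto

lemma vo_card_I (r : ℕ) : (voI F r).card = piq F r := by
  rw [piq, ← Nat.card_eq_finsetCard]
  exact Nat.card_congr (Equiv.subtypeEquivRight fun x => vo_mem_I)

/-- monic irreducibles of degree at most n -/
noncomputable def voP (n : ℕ) : Finset F[X] := by
  classical exact (Finset.range (n + 1)).biUnion (voI F)

variable {F} in
lemma vo_mem_P {n : ℕ} {f : F[X]} : f ∈ voP F n ↔ f.Monic ∧ Irreducible f ∧ f.natDegree ≤ n := by
  simp [voP, vo_mem_I]; grind

lemma vo_sum_P (n : ℕ) (g : ℕ → ℝ) :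
    ∑ l ∈ voP F n, g l.natDegree = ∑ r ∈ Finset.range (n + 1), (piq F r : ℝ) * g r := by
  classical
  rw [← Finset.sum_fiberwise_of_maps_to (s := voP F n) (t := Finset.range (n + 1))
    (g := fun l => l.natDegree)]
  · refine Finset.sum_congr rfl fun r hr => ?_
    have : (voP F n).filter (fun l => l.natDegree = r) = voI F r := by
      ext l
      rw [Finset.mem_range] at hr
      rw [Finset.mem_filter, vo_mem_P, vo_mem_I]; grind
    rw [this, ← vo_card_I, ← nsmul_eq_mul, ← Finset.sum_const]
    refine Finset.sum_congr rfl fun l hl => ?_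
    rw [(vo_mem_I.1 hl).2.2]
  · intro l hl
    rw [vo_mem_P] at hl
    simp; omega

lemma vo_piq_zero : piq F 0 = 0 := by
  rw [← vo_card_I, Finset.card_eq_zero, Finset.eq_empty_iff_forall_notMem]
  intro l hl
  rw [vo_mem_I] at hl
  exact absurd hl.2.2 hl.2.1.natDegree_pos.ne'

lemma vo_gauss (r : ℕ) (hr : r ≠ 0) :
    ∑ d ∈ r.divisors, piq F d * d = Fintype.card F ^ r := by
  classical
  set Q : F[X] := X ^ (Nat.card F) ^ r - X with hQ
  have hq : 1 < Nat.card F := Finite.one_lt_card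
  have hdeg : Q.natDegree = Nat.card F ^ r :=
    FiniteField.X_pow_card_pow_sub_X_natDegree_eq F hr hq
  have hQ0 : Q ≠ 0 := FiniteField.X_pow_card_pow_sub_X_ne_zero _ hr hq
  have hsq : Squarefree Q := by
    obtain ⟨p, hp⟩ := CharP.exists F
    refine (galois_poly_separable p _ ?_).squarefree
    have : p ∣ Nat.card F := by
      have := FiniteField.cast_card_eq_zero F
      rw [Nat.card_eq_fintype_card]
      exact (CharP.cast_eq_zero_iff F p _).1 this
    exact dvd_pow this hr
  have hnd := (UniqueFactorizationMonoid.squarefree_iff_nodup_normalizedFactors hQ0).1 hsq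
  have hset : (UniqueFactorizationMonoid.normalizedFactors Q).toFinset =
      r.divisors.biUnion (voI F) := by
    ext l
    rw [Multiset.mem_toFinset, Finset.mem_biUnion]
    constructor
    · intro h
      have h1 := UniqueFactorizationMonoid.irreducible_of_normalized_factor l h
      have h2 := UniqueFactorizationMonoid.dvd_of_mem_normalizedFactors h
      have h3 := UniqueFactorizationMonoid.normalize_normalized_factor l h
      refine ⟨l.natDegree, Nat.mem_divisors.2
        ⟨h1.natDegree_dvd_iff_dvd_X_pow_card_pow_sub_X.2 h2, hr⟩, vo_mem_I.2 ⟨?_, h1, rfl⟩⟩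
      rw [← h3]; exact Polynomial.monic_normalize h1.ne_zero
    · rintro ⟨d, hd, hl⟩
      rw [vo_mem_I] at hl
      obtain ⟨hm, hi, rfl⟩ := hl
      have h2 := hi.natDegree_dvd_iff_dvd_X_pow_card_pow_sub_X.1 (Nat.dvd_of_mem_divisors hd)
      obtain ⟨y, hy, hay⟩ := UniqueFactorizationMonoid.exists_mem_normalizedFactors_of_dvd hQ0 hi h2
      have h3 := UniqueFactorizationMonoid.normalize_normalized_factor y hy
      have : l = y := by
        rw [← h3, ← hm.normalize_eq_self]
        exact normalize_eq_normalize_iff_associated.2 hay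
      rwa [this]
  have hprod := UniqueFactorizationMonoid.prod_normalizedFactors hQ0
  have hd2 : (UniqueFactorizationMonoid.normalizedFactors Q).prod.natDegree = Nat.card F ^ r := by
    rw [← hdeg]
    exact natDegree_eq_of_degree_eq (degree_eq_degree_of_associated hprod)
  rw [natDegree_multiset_prod _ (UniqueFactorizationMonoid.zero_notMem_normalizedFactors Q)] at hd2
  rw [← Nat.card_eq_fintype_card, ← hd2]
  have : (Multiset.map natDegree (UniqueFactorizationMonoid.normalizedFactors Q)).sum =
      ∑ l ∈ (UniqueFactorizationMonoid.normalizedFactors Q).toFinset, l.natDegree := by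
    rw [Finset.sum, Multiset.toFinset_val, hnd.dedup]
  rw [this, hset, Finset.sum_biUnion]
  · refine Finset.sum_congr rfl fun d _ => ?_
    rw [Finset.sum_congr rfl fun l hl => (vo_mem_I.1 hl).2.2, Finset.sum_const, vo_card_I]
    simp
  · intro a _ b _ hab
    rw [Function.onFun, Finset.disjoint_left]
    intro l hl hl'
    exact hab ((vo_mem_I.1 hl).2.2.symm.trans (vo_mem_I.1 hl').2.2)

lemma vo_piq_le (r : ℕ) : piq F r * r ≤ Fintype.card F ^ r := by
  rcases eq_or_ne r 0 with rfl | hr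
  · simp
  rw [← vo_gauss F r hr]
  exact Finset.single_le_sum (f := fun d => piq F d * d) (fun _ _ => Nat.zero_le _)
    (Nat.mem_divisors_self r hr)

lemma vo_piq_ge (r : ℕ) (hr : r ≠ 0) :
    Fintype.card F ^ r ≤ piq F r * r + 2 * Fintype.card F ^ (r / 2) := by
  rw [← vo_gauss F r hr]
  rw [← Nat.insert_self_properDivisors hr, Finset.sum_insert Nat.self_notMem_properDivisors]
  refine Nat.add_le_add_left ?_ _
  have hq : 2 ≤ Fintype.card F := Fintype.one_lt_card
  calc ∑ d ∈ r.properDivisors, piq F d * d ≤ ∑ d ∈ r.properDivisors, Fintype.card F ^ d :=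
        Finset.sum_le_sum fun d _ => vo_piq_le F d
    _ ≤ ∑ d ∈ Finset.range (r / 2 + 1), Fintype.card F ^ d := by
        refine Finset.sum_le_sum_of_subset fun d hd => ?_
        rw [Nat.mem_properDivisors] at hd
        obtain ⟨⟨c, hc⟩, hlt⟩ := hd
        rw [Finset.mem_range]
        have : 2 ≤ c := by
          by_contra hcon
          have : c = 0 ∨ c = 1 := by omega
          rcases this with rfl | rfl <;> simp_all
        have : d * 2 ≤ d * c := Nat.mul_le_mul_left d this
        omega
    _ ≤ 2 * Fintype.card F ^ (r / 2) := by
        generalize r / 2 = m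
        induction m with
        | zero => simp
        | succ m ih =>
          rw [Finset.sum_range_succ]
          have : 2 * Fintype.card F ^ m ≤ Fintype.card F ^ (m + 1) := by
            rw [pow_succ, mul_comm]; exact Nat.mul_le_mul_left _ hq
          omega

end Counting
section Exact

variable (F : Type*) [Field F] [Fintype F]

open Classical in
/-- divisibility indicator -/
noncomputable def voD (g f : F[X]) : ℝ := if g ∣ f then 1 else 0

/-- density of a multiple of a polynomial of degree d among monics of degree n -/
noncomputable def voT (n d : ℕ) : ℝ := if d ≤ n then ((Fintype.card F : ℝ) ^ d)⁻¹ else 0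

lemma vo_sum_D (n : ℕ) (g : F[X]) (hg : g.Monic) :
    ∑ f ∈ voM F n, voD F g f = (Fintype.card F : ℝ) ^ n * voT F n g.natDegree := by
  classical
  have hq : (Fintype.card F : ℝ) ≠ 0 := by exact_mod_cast Fintype.card_ne_zero
  simp only [voD, voT]
  rw [Finset.sum_boole, vo_count_dvd F n g hg]
  split_ifs with h
  · push_cast
    rw [pow_sub₀ _ hq h]
  · simp

lemma vo_D_mul (g h f : F[X]) (hc : IsCoprime g h) : voD F g f * voD F h f = voD F (g * h) f := by
  classical
  simp only [voD]
  have : g * h ∣ f ↔ g ∣ f ∧ h ∣ f :=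
    ⟨fun H => ⟨(dvd_mul_right _ _).trans H, (dvd_mul_left _ _).trans H⟩,
      fun H => hc.mul_dvd H.1 H.2⟩
  rw [this]
  by_cases h1 : g ∣ f <;> by_cases h2 : h ∣ f <;> simp [h1, h2]

/-- indicator of exact divisibility -/
noncomputable def voE (l f : F[X]) : ℝ := voD F l f - voD F (l ^ 2) f

lemma vo_E_eq (l f : F[X]) [Decidable (l ∣ f ∧ ¬ l ^ 2 ∣ f)] :
    voE F l f = if l ∣ f ∧ ¬ l ^ 2 ∣ f then 1 else 0 := by
  classical
  simp only [voE, voD]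
  have : l ^ 2 ∣ f → l ∣ f := fun h => (dvd_pow_self l two_ne_zero).trans h
  by_cases h1 : l ∣ f <;> by_cases h2 : l ^ 2 ∣ f <;> simp [h1, h2] <;> tauto

lemma vo_omega (n : ℕ) (f : F[X]) (hf : f ∈ voM F n) :
    (omegak F 1 f : ℝ) = ∑ l ∈ voP F n, voE F l f := by
  classical
  rw [Finset.sum_congr rfl fun l _ => vo_E_eq F l f, Finset.sum_boole, omegak]
  congr 1
  rw [← Nat.card_eq_finsetCard]
  refine Nat.card_congr (Equiv.subtypeEquivRight fun l => ?_)
  rw [Finset.mem_filter, vo_mem_P]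
  rw [vo_mem_M] at hf
  simp only [pow_one, Nat.reduceAdd]
  constructor
  · rintro ⟨h1, h2, h3, h4⟩
    exact ⟨⟨h1, h2, hf.2 ▸ natDegree_le_of_dvd h3 hf.1.ne_zero⟩, h3, h4⟩
  · rintro ⟨⟨h1, h2, _⟩, h3, h4⟩
    exact ⟨h1, h2, h3, h4⟩

/-- single density -/
noncomputable def voe (n a : ℕ) : ℝ := voT F n a - voT F n (2 * a)

/-- pair density -/
noncomputable def voh (n a b : ℕ) : ℝ :=
  voT F n (a + b) - voT F n (2 * a + b) - voT F n (a + 2 * b) + voT F n (2 * a + 2 * b)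

lemma vo_sum_E (n : ℕ) (l : F[X]) (hl : l.Monic) :
    ∑ f ∈ voM F n, voE F l f = (Fintype.card F : ℝ) ^ n * voe F n l.natDegree := by
  simp only [voE, voe]
  rw [Finset.sum_sub_distrib, vo_sum_D F n l hl, vo_sum_D F n _ (hl.pow 2), hl.natDegree_pow]
  ring

lemma vo_sum_EE (n : ℕ) (l m : F[X]) (hl : l.Monic) (hm : m.Monic) (hli : Irreducible l)
    (hmi : Irreducible m) (hne : l ≠ m) :
    ∑ f ∈ voM F n, voE F l f * voE F m f =
      (Fintype.card F : ℝ) ^ n * voh F n l.natDegree m.natDegree := by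
  have hc : IsCoprime l m := by
    rw [hli.coprime_iff_not_dvd]
    intro hd
    exact hne (eq_of_monic_of_associated hl hm (hli.associated_of_dvd hmi hd))
  have : ∀ f, voE F l f * voE F m f = voD F (l * m) f - voD F (l ^ 2 * m) f - voD F (l * m ^ 2) f
      + voD F (l ^ 2 * m ^ 2) f := by
    intro f
    rw [← vo_D_mul F l m f hc, ← vo_D_mul F (l ^ 2) m f hc.pow_left,
      ← vo_D_mul F l (m ^ 2) f hc.pow_right, ← vo_D_mul F (l ^ 2) (m ^ 2) f hc.pow]
    simp only [voE]; ring
  simp only [this, Finset.sum_add_distrib, Finset.sum_sub_distrib]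
  rw [vo_sum_D F n _ (hl.mul hm), vo_sum_D F n _ ((hl.pow 2).mul hm),
    vo_sum_D F n _ (hl.mul (hm.pow 2)), vo_sum_D F n _ ((hl.pow 2).mul (hm.pow 2)),
    hl.natDegree_mul hm, (hl.pow 2).natDegree_mul hm, hl.natDegree_mul (hm.pow 2),
    (hl.pow 2).natDegree_mul (hm.pow 2), hl.natDegree_pow, hm.natDegree_pow]
  simp only [voh]; ring

lemma vo_sum_EE_self (n : ℕ) (l : F[X]) (hl : l.Monic) :
    ∑ f ∈ voM F n, voE F l f * voE F l f = (Fintype.card F : ℝ) ^ n * voe F n l.natDegree := by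
  classical
  rw [← vo_sum_E F n l hl]
  refine Finset.sum_congr rfl fun f _ => ?_
  rw [vo_E_eq]; split_ifs <;> simp

lemma vo_exact (n : ℕ) (t : ℝ) :
    ∑ᶠ f ∈ {f : F[X] | f.Monic ∧ f.natDegree = n}, ((omegak F 1 f : ℝ) - t) ^ 2 =
    (Fintype.card F : ℝ) ^ n *
      ((∑ a ∈ Finset.range (n + 1), ∑ b ∈ Finset.range (n + 1),
          (piq F a : ℝ) * (piq F b : ℝ) * voh F n a b)
        - (∑ r ∈ Finset.range (n + 1), (piq F r : ℝ) * voh F n r r)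
        + (1 - 2 * t) * (∑ r ∈ Finset.range (n + 1), (piq F r : ℝ) * voe F n r) + t ^ 2) := by
  classical
  rw [finsum_mem_eq_finite_toFinset_sum _ (vo_finite_monic F n)]
  change ∑ f ∈ voM F n, _ = _
  have h1 : ∑ f ∈ voM F n, (omegak F 1 f : ℝ) = (Fintype.card F : ℝ) ^ n *
      ∑ r ∈ Finset.range (n + 1), (piq F r : ℝ) * voe F n r := by
    rw [Finset.sum_congr rfl fun f hf => vo_omega F n f hf, Finset.sum_comm,
      Finset.sum_congr rfl fun l hl => vo_sum_E F n l (vo_mem_P.1 hl).1, ← Finset.mul_sum,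
      vo_sum_P F n (voe F n)]
  have h2 : ∑ f ∈ voM F n, (omegak F 1 f : ℝ) ^ 2 = (Fintype.card F : ℝ) ^ n *
      ((∑ a ∈ Finset.range (n + 1), ∑ b ∈ Finset.range (n + 1),
          (piq F a : ℝ) * (piq F b : ℝ) * voh F n a b)
        - (∑ r ∈ Finset.range (n + 1), (piq F r : ℝ) * voh F n r r)
        + (∑ r ∈ Finset.range (n + 1), (piq F r : ℝ) * voe F n r)) := by
    have : ∀ f ∈ voM F n, (omegak F 1 f : ℝ) ^ 2 =
        ∑ l ∈ voP F n, ∑ m ∈ voP F n, voE F l f * voE F m f := by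
      intro f hf
      rw [vo_omega F n f hf, sq, Finset.sum_mul_sum]
    rw [Finset.sum_congr rfl this, Finset.sum_comm]
    have h3 : ∀ l ∈ voP F n, ∑ f ∈ voM F n, ∑ m ∈ voP F n, voE F l f * voE F m f =
        (Fintype.card F : ℝ) ^ n * ((∑ b ∈ Finset.range (n + 1),
          (piq F b : ℝ) * voh F n l.natDegree b) - voh F n l.natDegree l.natDegree
            + voe F n l.natDegree) := by
      intro l hl
      rw [Finset.sum_comm]
      have h4 : ∀ m ∈ voP F n, ∑ f ∈ voM F n, voE F l f * voE F m f =
          (Fintype.card F : ℝ) ^ n * (voh F n l.natDegree m.natDegree +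
            if l = m then voe F n l.natDegree - voh F n l.natDegree l.natDegree else 0) := by
        intro m hm
        by_cases h : l = m
        · subst h
          rw [vo_sum_EE_self F n l (vo_mem_P.1 hl).1]; simp
        · rw [vo_sum_EE F n l m (vo_mem_P.1 hl).1 (vo_mem_P.1 hm).1 (vo_mem_P.1 hl).2.1
            (vo_mem_P.1 hm).2.1 h]
          simp [h]
      rw [Finset.sum_congr rfl h4, ← Finset.mul_sum, Finset.sum_add_distrib,
        vo_sum_P F n (fun b => voh F n l.natDegree b), Finset.sum_ite_eq, if_pos hl]
      ring
    rw [Finset.sum_congr rfl h3, ← Finset.mul_sum, Finset.sum_add_distrib, Finset.sum_sub_distrib,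
      vo_sum_P F n (voe F n), vo_sum_P F n (fun a => voh F n a a),
      vo_sum_P F n (fun a => ∑ b ∈ Finset.range (n + 1), (piq F b : ℝ) * voh F n a b)]
    simp only [Finset.mul_sum, mul_assoc]
  have h3 : ∀ f ∈ voM F n, ((omegak F 1 f : ℝ) - t) ^ 2 =
      (omegak F 1 f : ℝ) ^ 2 - 2 * t * (omegak F 1 f : ℝ) + t ^ 2 := fun f _ => by ring
  rw [Finset.sum_congr rfl h3, Finset.sum_add_distrib, Finset.sum_sub_distrib, ← Finset.mul_sum,
    h1, h2, Finset.sum_const, vo_card_M]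
  push_cast [nsmul_eq_mul]
  ring

end Exact
section Analysis

lemma vo_tail (v : ℕ → ℝ) (hv : Summable fun a : ℕ => (a : ℝ) ^ 2 * |v a|) (k : ℕ) (hk : 1 ≤ k) :
    ∃ K : ℝ, ∀ n : ℕ, 1 ≤ n →
      |(∑ a ∈ Finset.range (n + 1), if k * a ≤ n then v a else 0) - ∑' a, v a| ≤ K / n := by
  have h1 : Summable fun a : ℕ => (a : ℝ) * |v a| := by
    refine hv.of_nonneg_of_le (fun a => by positivity) fun a => ?_
    refine mul_le_mul_of_nonneg_right ?_ (abs_nonneg _)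
    exact_mod_cast Nat.le_self_pow two_ne_zero a
  have h0 : Summable v := by
    have : Summable fun a : ℕ => |v (a + 1)| := by
      refine ((summable_nat_add_iff 1).2 h1).of_nonneg_of_le (fun a => abs_nonneg _) fun a => ?_
      refine le_mul_of_one_le_left (abs_nonneg _) ?_
      push_cast; linarith [(Nat.cast_nonneg a : (0 : ℝ) ≤ a)]
    exact (summable_nat_add_iff 1).1 this.of_abs
  refine ⟨k * ∑' a : ℕ, (a : ℝ) * |v a|, fun n hn => ?_⟩
  have hn' : (0 : ℝ) < n := by exact_mod_cast hn
  have e1 : (∑ a ∈ Finset.range (n + 1), if k * a ≤ n then v a else 0) =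
      ∑' a, if k * a ≤ n then v a else 0 := by
    rw [tsum_eq_sum]
    intro a ha
    rw [Finset.mem_range, not_lt] at ha
    rw [if_neg]
    have : 1 * a ≤ k * a := Nat.mul_le_mul_right a hk
    omega
  have s1 : Summable fun a => if k * a ≤ n then v a else 0 := by
    refine Summable.of_norm_bounded h0.norm fun a => ?_
    split_ifs <;> simp
  rw [e1, ← s1.tsum_sub h0, ← Real.norm_eq_abs, mul_div_assoc, ← tsum_div_const, ← tsum_mul_left]
  refine tsum_of_norm_bounded (((h1.div_const _).mul_left _).hasSum) fun a => ?_
  rw [Real.norm_eq_abs]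
  split_ifs with h
  · simp; positivity
  · rw [zero_sub, abs_neg, ← mul_div_assoc, ← mul_assoc, le_div_iff₀ hn', mul_comm]
    refine mul_le_mul_of_nonneg_right ?_ (abs_nonneg _)
    exact_mod_cast (not_le.1 h).le

lemma vo_inner (n a : ℕ) (hn : 1 ≤ n) :
    ∑ b ∈ Finset.range (n + 1), (if n < 2 * a + b then (1 / b : ℝ) else 0) ≤ 6 * (a : ℝ) ^ 2 / n := by
  have hn' : (0 : ℝ) < n := by exact_mod_cast hn
  rw [← Finset.sum_filter]
  have hle : ∀ b ∈ (Finset.range (n + 1)).filter (fun b => n < 2 * a + b),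
      (1 / b : ℝ) ≤ 3 * a / n := by
    intro b hb
    rw [Finset.mem_filter, Finset.mem_range] at hb
    rcases Nat.eq_zero_or_pos b with rfl | hb0
    · simp; positivity
    · have : (0 : ℝ) < b := by exact_mod_cast hb0
      rw [div_le_div_iff₀ this hn']
      have ha : 1 ≤ a := by omega
      have : n ≤ 3 * a * b := by nlinarith
      rw [one_mul]; exact_mod_cast this
  have hcard : ((Finset.range (n + 1)).filter (fun b => n < 2 * a + b)).card ≤ 2 * a := by
    have : (Finset.range (n + 1)).filter (fun b => n < 2 * a + b) ⊆ Finset.Ico (n + 1 - 2 * a) (n + 1) := by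
      intro b hb
      rw [Finset.mem_filter, Finset.mem_range] at hb
      rw [Finset.mem_Ico]; omega
    refine (Finset.card_le_card this).trans ?_
    rw [Nat.card_Ico]; omega
  calc _ ≤ _ := Finset.sum_le_card_nsmul _ _ _ hle
    _ ≤ (2 * a : ℕ) * (3 * a / n : ℝ) := by
        rw [nsmul_eq_mul]
        refine mul_le_mul_of_nonneg_right (by exact_mod_cast hcard) (by positivity)
    _ = _ := by push_cast; ring

/-- hyperbola-type error -/
lemma vo_core (v : ℕ → ℝ) (hv : Summable fun a : ℕ => (a : ℝ) ^ 2 * |v a|) :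
    ∃ K : ℝ, ∀ n : ℕ, 1 ≤ n →
      ∑ a ∈ Finset.range (n + 1), ∑ b ∈ Finset.range (n + 1),
        (if n < 2 * a + b then |v a| * (1 / b : ℝ) else 0) ≤ K / n := by
  refine ⟨6 * ∑' a : ℕ, (a : ℝ) ^ 2 * |v a|, fun n hn => ?_⟩
  have hn' : (0 : ℝ) < n := by exact_mod_cast hn
  calc _ ≤ ∑ a ∈ Finset.range (n + 1), (6 / n) * ((a : ℝ) ^ 2 * |v a|) := by
        refine Finset.sum_le_sum fun a _ => ?_
        have := mul_le_mul_of_nonneg_left (vo_inner n a hn) (abs_nonneg (v a))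
        rw [Finset.mul_sum] at this
        simp only [mul_ite, mul_zero] at this
        refine this.trans (le_of_eq ?_)
        ring
    _ ≤ _ := by
        rw [← Finset.mul_sum, mul_div_right_comm]
        refine mul_le_mul_of_nonneg_left ?_ (by positivity)
        exact hv.sum_le_tsum _ fun a _ => by positivity

lemma vo_D_est (v p : ℕ → ℝ) (hv : Summable fun a : ℕ => (a : ℝ) ^ 2 * |v a|)
    (hp : ∀ b, |p b| ≤ 1 / b) :
    ∃ K : ℝ, ∀ n : ℕ, 1 ≤ n →
      |(∑ a ∈ Finset.range (n + 1), ∑ b ∈ Finset.range (n + 1),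
        (if 2 * a + b ≤ n then v a * p b else 0)) -
        (∑ a ∈ Finset.range (n + 1), v a) * ∑ b ∈ Finset.range (n + 1), p b| ≤ K / n := by
  obtain ⟨K, hK⟩ := vo_core v hv
  refine ⟨K, fun n hn => (le_trans ?_ (hK n hn))⟩
  rw [Finset.sum_mul_sum, ← Finset.sum_sub_distrib]
  refine (Finset.abs_sum_le_sum_abs _ _).trans (Finset.sum_le_sum fun a _ => ?_)
  rw [← Finset.sum_sub_distrib]
  refine (Finset.abs_sum_le_sum_abs _ _).trans (Finset.sum_le_sum fun b _ => ?_)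
  by_cases h : 2 * a + b ≤ n
  · rw [if_pos h, if_neg (by omega)]; simp
  · rw [if_neg h, if_pos (by omega), zero_sub, abs_neg, abs_mul]
    exact mul_le_mul_of_nonneg_left (hp b) (abs_nonneg _)

lemma vo_E_est (v : ℕ → ℝ) (hv : Summable fun a : ℕ => (a : ℝ) ^ 2 * |v a|) (hv0 : v 0 = 0) :
    ∃ K : ℝ, ∀ n : ℕ, 1 ≤ n →
      |(∑ a ∈ Finset.range (n + 1), ∑ b ∈ Finset.range (n + 1),
        (if 2 * a + 2 * b ≤ n then v a * v b else 0)) -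
        (∑ a ∈ Finset.range (n + 1), v a) * ∑ b ∈ Finset.range (n + 1), v b| ≤ K / n := by
  refine ⟨4 * (∑' a : ℕ, (a : ℝ) ^ 2 * |v a|) ^ 2, fun n hn => ?_⟩
  have hn' : (0 : ℝ) < n := by exact_mod_cast hn
  rw [Finset.sum_mul_sum, ← Finset.sum_sub_distrib]
  calc _ ≤ ∑ a ∈ Finset.range (n + 1), ∑ b ∈ Finset.range (n + 1),
          (4 / n) * (((a : ℝ) ^ 2 * |v a|) * ((b : ℝ) ^ 2 * |v b|)) := by
        refine (Finset.abs_sum_le_sum_abs _ _).trans (Finset.sum_le_sum fun a _ => ?_)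
        rw [← Finset.sum_sub_distrib]
        refine (Finset.abs_sum_le_sum_abs _ _).trans (Finset.sum_le_sum fun b _ => ?_)
        by_cases h : 2 * a + 2 * b ≤ n
        · rw [if_pos h, sub_self, abs_zero]; positivity
        · rw [if_neg h, zero_sub, abs_neg, abs_mul]
          rcases Nat.eq_zero_or_pos a with rfl | ha
          · simp [hv0]
          rcases Nat.eq_zero_or_pos b with rfl | hb
          · simp [hv0]
          have h1 : n ≤ 4 * (a ^ 2 * b ^ 2) := by
            have : a + b ≤ 2 * (a * b) := by nlinarith
            have h3 : 1 ≤ a * b := Nat.mul_pos ha hb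
            have : a * b ≤ (a * b) ^ 2 := Nat.le_self_pow two_ne_zero _
            rw [← mul_pow]; omega
          have h2 : (1 : ℝ) ≤ 4 / n * (a ^ 2 * b ^ 2) := by
            rw [div_mul_eq_mul_div, le_div_iff₀ hn', one_mul]; exact_mod_cast h1
          calc |v a| * |v b| ≤ (4 / n * (a ^ 2 * b ^ 2)) * (|v a| * |v b|) :=
                le_mul_of_one_le_left (by positivity) h2
            _ = _ := by ring
    _ = (4 / n) * (∑ a ∈ Finset.range (n + 1), ((a : ℝ) ^ 2 * |v a|)) ^ 2 := by
        rw [sq, Finset.sum_mul_sum, Finset.mul_sum]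
        simp only [Finset.mul_sum]
    _ ≤ _ := by
        rw [mul_div_right_comm]
        refine mul_le_mul_of_nonneg_left ?_ (by positivity)
        refine pow_le_pow_left₀ (Finset.sum_nonneg fun a _ => by positivity) ?_ 2
        exact hv.sum_le_tsum _ fun a _ => by positivity

/-- The exact identity for the reciprocal double sum. -/
lemma vo_recip (n : ℕ) :
    ∑ a ∈ Finset.range (n + 1), ∑ b ∈ Finset.range (n + 1),
      (if n < a + b then (1 / a : ℝ) * (1 / b) else 0) =
    ∑ a ∈ Finset.range (n + 1), (1 / (a : ℝ) ^ 2) := by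
  induction n with
  | zero => simp
  | succ n ih =>
    have key : ∑ a ∈ Finset.range (n + 1), ∑ b ∈ Finset.range (n + 1),
        (if a + b = n + 1 then (1 / a : ℝ) * (1 / b) else 0) =
        2 * (∑ a ∈ Finset.range (n + 1), (1 / a : ℝ)) * (1 / (n + 1 : ℝ)) := by
      have h1 : ∀ a ∈ Finset.range (n + 1), ∑ b ∈ Finset.range (n + 1),
          (if a + b = n + 1 then (1 / a : ℝ) * (1 / b) else 0) =
          if a = 0 then 0 else (1 / a + 1 / ((n + 1 - a : ℕ) : ℝ)) * (1 / (n + 1 : ℝ)) := by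
        intro a ha
        rw [Finset.mem_range] at ha
        rcases Nat.eq_zero_or_pos a with rfl | ha0
        · simp
        rw [if_neg ha0.ne', Finset.sum_eq_single (n + 1 - a)]
        · rw [if_pos (by omega)]
          have e : ((n + 1 - a : ℕ) : ℝ) = n + 1 - a := by
            rw [Nat.cast_sub (by omega)]; push_cast; ring
          have p1 : (0 : ℝ) < a := by exact_mod_cast ha0
          have p2 : (0 : ℝ) < n + 1 - a := by
            have : (a : ℝ) < n + 1 := by exact_mod_cast ha
            linarith
          have p3 : (0 : ℝ) < n + 1 := by positivity
          rw [e]; field_simp; ring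
        · intro b _ hb
          rw [if_neg (by omega)]
        · intro hb
          rw [Finset.mem_range] at hb; omega
      rw [Finset.sum_congr rfl h1, Finset.sum_range_succ', if_pos rfl, add_zero]
      simp only [Nat.succ_ne_zero, if_false]
      rw [← Finset.sum_mul, Finset.sum_add_distrib]
      congr 1
      have h2 : ∑ x ∈ Finset.range n, 1 / ((n + 1 - (x + 1) : ℕ) : ℝ) =
          ∑ x ∈ Finset.range n, 1 / ((x + 1 : ℕ) : ℝ) := by
        rw [← Finset.sum_range_reflect]
        refine Finset.sum_congr rfl fun x hx => ?_
        rw [Finset.mem_range] at hx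
        congr 2; omega
      rw [h2, Finset.sum_range_succ']
      simp; ring
    have e1 : ∀ a ∈ Finset.range (n + 1), ∑ b ∈ Finset.range (n + 1),
        (if n < a + b then (1 / a : ℝ) * (1 / b) else 0) =
        (∑ b ∈ Finset.range (n + 1), (if n + 1 < a + b then (1 / a : ℝ) * (1 / b) else 0)) +
        ∑ b ∈ Finset.range (n + 1), (if a + b = n + 1 then (1 / a : ℝ) * (1 / b) else 0) := by
      intro a _
      rw [← Finset.sum_add_distrib]
      refine Finset.sum_congr rfl fun b _ => ?_
      by_cases h1 : a + b = n + 1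
      · rw [if_pos (by omega), if_neg (by omega), if_pos h1]; simp
      · by_cases h2 : n < a + b
        · rw [if_pos h2, if_pos (by omega), if_neg h1]; simp
        · rw [if_neg h2, if_neg (by omega), if_neg h1]; simp
    rw [Finset.sum_congr rfl e1, Finset.sum_add_distrib, key] at ih
    rw [Finset.sum_range_succ _ (n + 1), Finset.sum_range_succ _ (n + 1)]
    simp only [Finset.sum_range_succ _ (n + 1)]
    rw [Finset.sum_add_distrib, ← ih]
    have e2 : ∑ a ∈ Finset.range (n + 1),
        (if n + 1 < a + (n + 1) then (1 / a : ℝ) * (1 / ((n + 1 : ℕ) : ℝ)) else 0) =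
        (∑ a ∈ Finset.range (n + 1), (1 / a : ℝ)) * (1 / (n + 1 : ℝ)) := by
      rw [Finset.sum_mul]
      refine Finset.sum_congr rfl fun a _ => ?_
      rcases Nat.eq_zero_or_pos a with rfl | ha
      · simp
      · rw [if_pos (by omega)]; push_cast; rfl
    have e3 : ∑ b ∈ Finset.range (n + 1),
        (if n + 1 < n + 1 + b then (1 / ((n + 1 : ℕ) : ℝ)) * (1 / b : ℝ) else 0) =
        (∑ a ∈ Finset.range (n + 1), (1 / a : ℝ)) * (1 / (n + 1 : ℝ)) := by
      rw [← e2]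
      refine Finset.sum_congr rfl fun a _ => ?_
      rw [add_comm (n + 1) a, mul_comm]
    rw [e2, e3, if_pos (by omega)]
    push_cast
    have e4 : 1 / ((n : ℝ) + 1) ^ 2 = 1 / ((n : ℝ) + 1) * (1 / ((n : ℝ) + 1)) := by field_simp
    rw [e4]
    ring

lemma vo_zeta : ∃ K : ℝ, ∀ n : ℕ, 1 ≤ n →
    |(∑ a ∈ Finset.range (n + 1), (1 / (a : ℝ) ^ 2)) - π ^ 2 / 6| ≤ K / n := by
  refine ⟨1, fun n hn => ?_⟩
  have hn' : (0 : ℝ) < n := by exact_mod_cast hn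
  have hs := hasSum_zeta_two
  have h1 : ∑ a ∈ Finset.range (n + 1), (1 / (a : ℝ) ^ 2) ≤ π ^ 2 / 6 :=
    sum_le_hasSum _ (fun a _ => by positivity) hs
  have h2 : π ^ 2 / 6 ≤ ∑ a ∈ Finset.range (n + 1), (1 / (a : ℝ) ^ 2) + 1 / n := by
    refine le_of_tendsto' (hs.tendsto_sum_nat.comp (tendsto_add_atTop_nat (n + 1))) fun m => ?_
    have : ∀ m : ℕ, ∑ a ∈ Finset.range (m + (n + 1)), (1 / (a : ℝ) ^ 2) ≤
        ∑ a ∈ Finset.range (n + 1), (1 / (a : ℝ) ^ 2) + 1 / (n : ℝ) - 1 / ((n : ℝ) + (m : ℝ)) := by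
      intro m
      induction m with
      | zero => simp
      | succ m ih =>
        rw [show m + 1 + (n + 1) = (m + (n + 1)) + 1 by ring, Finset.sum_range_succ]
        have : 1 / (((m + (n + 1) : ℕ) : ℝ)) ^ 2 ≤ 1 / (n + m : ℝ) - 1 / (n + (m + 1 : ℕ)) := by
          push_cast
          rw [div_sub_div _ _ (by positivity) (by positivity), div_le_div_iff₀ (by positivity) (by positivity)]
          nlinarith [(Nat.cast_nonneg m : (0 : ℝ) ≤ m)]
        linarith
    refine (this m).trans ?_
    have : (0 : ℝ) ≤ 1 / (n + m) := by positivity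
    linarith
  rw [abs_le]; constructor <;> linarith

lemma vo_harm : ∃ K : ℝ, ∀ n : ℕ, 1 ≤ n →
    |(∑ a ∈ Finset.range (n + 1), (1 / (a : ℝ))) - Real.log n - Real.eulerMascheroniConstant|
      ≤ K / n := by
  refine ⟨1, fun n hn => ?_⟩
  have hn' : (0 : ℝ) < n := by exact_mod_cast hn
  have hH : ∑ a ∈ Finset.range (n + 1), (1 / (a : ℝ)) = harmonic n := by
    rw [Finset.sum_range_succ', harmonic]
    simp
  have h1 := Real.eulerMascheroniSeq_lt_eulerMascheroniConstant n
  have h2 := Real.eulerMascheroniConstant_lt_eulerMascheroniSeq' n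
  rw [Real.eulerMascheroniSeq] at h1
  rw [Real.eulerMascheroniSeq', if_neg (by omega)] at h2
  have h3 : Real.log (n + 1) - Real.log n ≤ 1 / n := by
    rw [← Real.log_div (by positivity) (by positivity)]
    refine (Real.log_le_sub_one_of_pos (by positivity)).trans (le_of_eq ?_)
    field_simp; ring
  rw [hH, abs_le]; constructor <;> linarith

lemma vo_C_est (p : ℕ → ℝ) (hv : Summable fun a : ℕ => (a : ℝ) ^ 2 * |p a - 1 / a|)
    (hp : ∀ b, |p b| ≤ 1 / b) :
    ∃ K : ℝ, ∀ n : ℕ, 1 ≤ n →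
      |(∑ a ∈ Finset.range (n + 1), ∑ b ∈ Finset.range (n + 1),
        (if a + b ≤ n then p a * p b else 0)) -
        ((∑ a ∈ Finset.range (n + 1), p a) ^ 2 - π ^ 2 / 6)| ≤ K / n := by
  obtain ⟨K, hK⟩ := vo_core (fun a => p a - 1 / a) hv
  obtain ⟨Z, hZ⟩ := vo_zeta
  refine ⟨2 * K + Z, fun n hn => ?_⟩
  have hK := hK n hn
  have hZ := hZ n hn
  set S := ∑ a ∈ Finset.range (n + 1), ∑ b ∈ Finset.range (n + 1),
        (if n < 2 * a + b then |p a - 1 / a| * (1 / b : ℝ) else 0) with hS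
  have hS' : S = ∑ a ∈ Finset.range (n + 1), ∑ b ∈ Finset.range (n + 1),
        (if n < 2 * b + a then |p b - 1 / b| * (1 / a : ℝ) else 0) := by
    rw [hS, Finset.sum_comm]
  have main : |(∑ a ∈ Finset.range (n + 1), ∑ b ∈ Finset.range (n + 1),
        (if a + b ≤ n then p a * p b else 0)) - (∑ a ∈ Finset.range (n + 1), p a) ^ 2
        + ∑ a ∈ Finset.range (n + 1), (1 / (a : ℝ) ^ 2)| ≤ S + S := by
    nth_rw 2 [hS']
    rw [hS, ← vo_recip, sq, Finset.sum_mul_sum, ← Finset.sum_sub_distrib, ← Finset.sum_add_distrib,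
      ← Finset.sum_add_distrib]
    refine (Finset.abs_sum_le_sum_abs _ _).trans (Finset.sum_le_sum fun a _ => ?_)
    rw [← Finset.sum_sub_distrib, ← Finset.sum_add_distrib, ← Finset.sum_add_distrib]
    refine (Finset.abs_sum_le_sum_abs _ _).trans (Finset.sum_le_sum fun b _ => ?_)
    by_cases h : a + b ≤ n
    · rw [if_pos h, if_neg (by omega)]
      simp only [sub_self, add_zero, abs_zero]
      split_ifs <;> positivity
    · rw [if_neg h, if_pos (by omega), if_pos (by omega), if_pos (by omega)]
      have e : 0 - p a * p b + 1 / (a : ℝ) * (1 / b) =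
        -((p a - 1 / a) * (1 / b)) + -(p a * (p b - 1 / b)) := by ring
      rw [e]
      refine (abs_add_le _ _).trans (add_le_add ?_ ?_)
      · rw [abs_neg, abs_mul, abs_of_nonneg (by positivity : (0 : ℝ) ≤ 1 / b)]
      · rw [abs_neg, abs_mul, mul_comm]
        exact mul_le_mul_of_nonneg_left (hp a) (abs_nonneg _)
  rw [add_div, two_mul, add_div]
  rw [abs_le] at *
  constructor <;> linarith [main.1, main.2, hZ.1, hZ.2]

end Analysis
section Arithmetic

variable (F : Type*) [Field F] [Fintype F]

/-- weighted prime count -/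
noncomputable def vou (m r : ℕ) : ℝ := (piq F r : ℝ) * (((Fintype.card F : ℝ) ^ r) ^ m)⁻¹

lemma vo_u_nonneg (m r : ℕ) : 0 ≤ vou F m r := by unfold vou; positivity

lemma vo_u_zero (m : ℕ) : vou F m 0 = 0 := by simp [vou, vo_piq_zero]

lemma vo_q_two : (2 : ℝ) ≤ Fintype.card F := by
  have : 2 ≤ Fintype.card F := Fintype.one_lt_card
  exact_mod_cast this

lemma vo_u_le (m r : ℕ) (hm : 2 ≤ m) : vou F m r ≤ (1 / 2 : ℝ) ^ r := by
  have hq := vo_q_two F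
  rcases Nat.eq_zero_or_pos r with rfl | hr
  · simp [vo_u_zero]
  have h1 : (piq F r : ℝ) ≤ (Fintype.card F : ℝ) ^ r := by
    have : piq F r ≤ Fintype.card F ^ r :=
      (Nat.le_mul_of_pos_right _ hr).trans (vo_piq_le F r)
    exact_mod_cast this
  have hq1 : (1 : ℝ) ≤ (Fintype.card F : ℝ) ^ r := one_le_pow₀ (by linarith)
  have h2 : (((Fintype.card F : ℝ) ^ r) ^ m)⁻¹ ≤ (((Fintype.card F : ℝ) ^ r) ^ 2)⁻¹ :=
    inv_anti₀ (by positivity) (pow_le_pow_right₀ hq1 hm)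
  calc vou F m r ≤ (Fintype.card F : ℝ) ^ r * (((Fintype.card F : ℝ) ^ r) ^ 2)⁻¹ :=
        mul_le_mul h1 h2 (by positivity) (by positivity)
    _ = ((Fintype.card F : ℝ) ^ r)⁻¹ := by field_simp
    _ ≤ ((2 : ℝ) ^ r)⁻¹ := inv_anti₀ (by positivity) (pow_le_pow_left₀ (by norm_num) hq r)
    _ = _ := by simp

lemma vo_u_summable (m : ℕ) (hm : 2 ≤ m) :
    Summable fun a : ℕ => (a : ℝ) ^ 2 * |vou F m a| := by
  have := summable_pow_mul_geometric_of_norm_lt_one (R := ℝ) 2 (r := 1 / 2) (by norm_num)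
  refine this.of_nonneg_of_le (fun a => by positivity) fun a => ?_
  rw [abs_of_nonneg (vo_u_nonneg F m a)]
  exact mul_le_mul_of_nonneg_left (vo_u_le F m a hm) (by positivity)

lemma vo_u_summable' (m : ℕ) (hm : 2 ≤ m) : Summable (vou F m) :=
  (summable_geometric_of_lt_one (r := 1 / 2) (by norm_num) (by norm_num)).of_nonneg_of_le
    (vo_u_nonneg F m) (fun a => vo_u_le F m a hm)

lemma vo_p_le (r : ℕ) : |vou F 1 r| ≤ 1 / r := by
  have hq := vo_q_two F
  rw [abs_of_nonneg (vo_u_nonneg F 1 r)]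
  rcases Nat.eq_zero_or_pos r with rfl | hr
  · simp [vo_u_zero]
  have hr' : (0 : ℝ) < r := by exact_mod_cast hr
  have h1 : (piq F r : ℝ) * r ≤ (Fintype.card F : ℝ) ^ r := by exact_mod_cast vo_piq_le F r
  have : (0 : ℝ) < (Fintype.card F : ℝ) ^ r := by positivity
  rw [vou, pow_one, ← div_eq_mul_inv, div_le_div_iff₀ this hr', one_mul]
  exact h1

lemma vo_eps_le (r : ℕ) : |vou F 1 r - 1 / r| ≤ 2 * (1 / √2) ^ r := by
  have hq := vo_q_two F
  rcases Nat.eq_zero_or_pos r with rfl | hr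
  · simp [vo_u_zero]
  have hr' : (1 : ℝ) ≤ r := by exact_mod_cast hr
  have h0 := (abs_le.1 (vo_p_le F r)).2
  have hQ : (0 : ℝ) < (Fintype.card F : ℝ) ^ r := by positivity
  have h1 : (Fintype.card F : ℝ) ^ r ≤ (piq F r : ℝ) * r + 2 * (Fintype.card F : ℝ) ^ (r / 2) := by
    exact_mod_cast vo_piq_ge F r hr.ne'
  rw [abs_of_nonpos (by linarith), neg_sub]
  have hs : (0 : ℝ) < √2 := by positivity
  have h2 : (√2) ^ r ≤ (Fintype.card F : ℝ) ^ (r - r / 2) := by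
    calc (√2) ^ r ≤ (√2) ^ (2 * (r - r / 2)) := by
          refine pow_le_pow_right₀ ?_ (by omega)
          rw [Real.one_le_sqrt]; norm_num
      _ = 2 ^ (r - r / 2) := by rw [pow_mul, Real.sq_sqrt (by norm_num)]
      _ ≤ _ := pow_le_pow_left₀ (by norm_num) hq _
  have h3 : (Fintype.card F : ℝ) ^ r = (Fintype.card F : ℝ) ^ (r / 2) *
      (Fintype.card F : ℝ) ^ (r - r / 2) := by rw [← pow_add]; congr 1; omega
  calc 1 / (r : ℝ) - vou F 1 r
      = ((Fintype.card F : ℝ) ^ r - (piq F r : ℝ) * r) / (r * (Fintype.card F : ℝ) ^ r) := by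
        rw [vou, pow_one]; field_simp
    _ ≤ (2 * (Fintype.card F : ℝ) ^ (r / 2)) / (1 * (Fintype.card F : ℝ) ^ r) := by
        refine div_le_div₀ (by positivity) (by linarith) (by positivity) ?_
        exact mul_le_mul_of_nonneg_right hr' hQ.le
    _ = 2 * (1 / (Fintype.card F : ℝ) ^ (r - r / 2)) := by
        rw [h3]; field_simp
    _ ≤ 2 * (1 / √2) ^ r := by
        rw [one_div_pow]
        exact mul_le_mul_of_nonneg_left (one_div_le_one_div_of_le (by positivity) h2) (by norm_num)

lemma vo_sqrt_lt : ‖(1 / √2 : ℝ)‖ < 1 := by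
  rw [Real.norm_eq_abs, abs_of_nonneg (by positivity), div_lt_one (by positivity)]
  rw [Real.lt_sqrt (by norm_num)]; norm_num

lemma vo_eps_summable : Summable fun a : ℕ => (a : ℝ) ^ 2 * |vou F 1 a - 1 / a| := by
  have := (summable_pow_mul_geometric_of_norm_lt_one (R := ℝ) 2 vo_sqrt_lt).mul_left 2
  refine this.of_nonneg_of_le (fun a => by positivity) fun a => ?_
  calc (a : ℝ) ^ 2 * |vou F 1 a - 1 / a| ≤ (a : ℝ) ^ 2 * (2 * (1 / √2) ^ a) :=
        mul_le_mul_of_nonneg_left (vo_eps_le F a) (by positivity)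
    _ = _ := by ring

lemma vo_A1 : A1 F = Real.eulerMascheroniConstant + ∑' r : ℕ, (vou F 1 r - 1 / r) := by
  have hq := vo_q_two F
  rw [A1]
  congr 1
  refine tsum_congr fun r => ?_
  split_ifs with h
  · subst h; simp [vo_u_zero]
  · have : (r : ℝ) ≠ 0 := by exact_mod_cast h
    rw [vou, pow_one]; field_simp

lemma vo_Lc (m : ℕ) (hm : 2 ≤ m) : Lc F m = ∑' r, vou F m r := by
  classical
  set g : ℕ → ℝ := fun r => (((Fintype.card F : ℝ) ^ r) ^ m)⁻¹ with hg
  have hg0 : ∀ r, 0 ≤ g r := fun r => by positivity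
  have hs := vo_u_summable' F m hm
  have hsum : Summable fun l : {l : F[X] // l.Monic ∧ Irreducible l} => g (l : F[X]).natDegree := by
    refine summable_of_sum_le (c := ∑' r, vou F m r) (fun l => hg0 _) fun s => ?_
    set n := s.sup fun l => (l : F[X]).natDegree with hn
    have e : ∑ l ∈ s, g (l : F[X]).natDegree =
        ∑ l ∈ s.map (Function.Embedding.subtype _), g l.natDegree := by
      rw [Finset.sum_map]; rfl
    rw [e]
    calc _ ≤ ∑ l ∈ voP F n, g l.natDegree := by
          refine Finset.sum_le_sum_of_subset_of_nonneg ?_ fun l _ _ => hg0 _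
          intro l hl
          rw [Finset.mem_map] at hl
          obtain ⟨l', hl', rfl⟩ := hl
          exact vo_mem_P.2 ⟨l'.2.1, l'.2.2,
            Finset.le_sup (f := fun l : {l : F[X] // l.Monic ∧ Irreducible l} =>
              (l : F[X]).natDegree) hl'⟩
      _ = ∑ r ∈ Finset.range (n + 1), vou F m r := vo_sum_P F n g
      _ ≤ _ := hs.sum_le_tsum _ fun r _ => vo_u_nonneg F m r
  have h := hsum.hasSum.tsum_fiberwise
    (fun l : {l : F[X] // l.Monic ∧ Irreducible l} => (l : F[X]).natDegree)
  have h' := h.tsum_eq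
  change Lc F m = _
  rw [show Lc F m = ∑' l : {l : F[X] // l.Monic ∧ Irreducible l}, g (l : F[X]).natDegree from rfl,
    ← h']
  refine tsum_congr fun r => ?_
  have h1 : ∀ b : ((fun l : {l : F[X] // l.Monic ∧ Irreducible l} => (l : F[X]).natDegree) ⁻¹' {r}),
      g ((b : {l : F[X] // l.Monic ∧ Irreducible l}) : F[X]).natDegree = g r := by
    intro b; exact congrArg g b.2
  rw [tsum_congr h1, tsum_const, nsmul_eq_mul, vou]
  congr 2
  rw [piq]
  refine Nat.card_congr ⟨fun b => ⟨b.1.1, b.1.2.1, b.1.2.2, b.2⟩,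
    fun l => ⟨⟨l.1, l.2.1, l.2.2.1⟩, l.2.2.2⟩, fun _ => rfl, fun _ => rfl⟩

end Arithmetic
section Final

variable (F : Type*) [Field F] [Fintype F]

lemma vo_pair (n a b : ℕ) : (piq F a : ℝ) * (piq F b : ℝ) * voh F n a b =
    (if a + b ≤ n then vou F 1 a * vou F 1 b else 0)
    - (if 2 * a + b ≤ n then vou F 2 a * vou F 1 b else 0)
    - (if 2 * b + a ≤ n then vou F 2 b * vou F 1 a else 0)
    + (if 2 * a + 2 * b ≤ n then vou F 2 a * vou F 2 b else 0) := by
  simp only [voh, voT, vou, add_comm (2 * b) a]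
  rw [mul_add, mul_sub, mul_sub]
  simp only [mul_ite, mul_zero]
  congr 1
  · congr 1
    · congr 1
      · congr 1; rw [pow_add, mul_inv]; ring
      · congr 1; rw [pow_add, mul_inv, pow_mul']; ring
    · congr 1; rw [pow_add, mul_inv, pow_mul']; ring
  · congr 1; rw [pow_add, mul_inv, pow_mul', pow_mul']; ring

lemma vo_diag (n r : ℕ) : (piq F r : ℝ) * voh F n r r =
    (if 2 * r ≤ n then vou F 2 r else 0) - 2 * (if 3 * r ≤ n then vou F 3 r else 0)
    + (if 4 * r ≤ n then vou F 4 r else 0) := by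
  simp only [voh, voT, vou]
  rw [show r + r = 2 * r by ring, show 2 * r + r = 3 * r by ring, show r + 2 * r = 3 * r by ring,
    show 2 * r + 2 * r = 4 * r by ring]
  simp only [pow_mul']
  split_ifs <;> ring

lemma vo_single (n r : ℕ) (hr : r ∈ Finset.range (n + 1)) : (piq F r : ℝ) * voe F n r =
    vou F 1 r - (if 2 * r ≤ n then vou F 2 r else 0) := by
  rw [Finset.mem_range] at hr
  simp only [voe, voT, vou]
  rw [if_pos (by omega), pow_mul', pow_one]
  split_ifs <;> ring

lemma vo_bigO {f : ℕ → ℝ} (h : ∃ K : ℝ, ∀ n : ℕ, 1 ≤ n → |f n| ≤ K / n) :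
    f =O[atTop] fun n : ℕ => (1 / n : ℝ) := by
  obtain ⟨K, hK⟩ := h
  refine IsBigO.of_bound K ?_
  filter_upwards [eventually_ge_atTop 1] with n hn
  rw [Real.norm_eq_abs, Real.norm_eq_abs, abs_of_nonneg (by positivity : (0 : ℝ) ≤ 1 / n)]
  refine (hK n hn).trans (le_of_eq ?_)
  ring

end Final

/-- Variance-type estimate for ω₁. -/
theorem variance_omega_one (F : Type*) [Field F] [Fintype F] :
    (fun n : ℕ =>
        (∑ᶠ f ∈ {f : Polynomial F | f.Monic ∧ f.natDegree = n},
            ((omegak F 1 f : ℝ) - Real.log n) ^ 2) -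
          ((Fintype.card F : ℝ) ^ n * Real.log n +
            ((A1 F - 2 * Lc F 2) * (A1 F + 1) - Real.pi ^ 2 / 6 + (Lc F 2) ^ 2 +
              2 * Lc F 3 - Lc F 4) * (Fintype.card F : ℝ) ^ n))
      =O[atTop] (fun n : ℕ => (Fintype.card F : ℝ) ^ n * Real.log n / n) := by
  have hL2 := vo_Lc F 2 le_rfl
  have hL3 := vo_Lc F 3 (by norm_num)
  have hL4 := vo_Lc F 4 (by norm_num)
  have hA1 := vo_A1 F
  set L2 := Lc F 2
  set L3 := Lc F 3
  set L4 := Lc F 4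
  set A := A1 F
  -- the sums
  let sA : ℕ → ℝ := fun n => ∑ a ∈ Finset.range (n + 1), vou F 1 a
  let sU : ℕ → ℝ := fun n => ∑ a ∈ Finset.range (n + 1), vou F 2 a
  let sB : ℕ → ℝ := fun n => ∑ a ∈ Finset.range (n + 1), if 2 * a ≤ n then vou F 2 a else 0
  let sD3 : ℕ → ℝ := fun n => ∑ a ∈ Finset.range (n + 1), if 3 * a ≤ n then vou F 3 a else 0
  let sD4 : ℕ → ℝ := fun n => ∑ a ∈ Finset.range (n + 1), if 4 * a ≤ n then vou F 4 a else 0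
  let sC : ℕ → ℝ := fun n => ∑ a ∈ Finset.range (n + 1), ∑ b ∈ Finset.range (n + 1),
        (if a + b ≤ n then vou F 1 a * vou F 1 b else 0)
  let sD : ℕ → ℝ := fun n => ∑ a ∈ Finset.range (n + 1), ∑ b ∈ Finset.range (n + 1),
        (if 2 * a + b ≤ n then vou F 2 a * vou F 1 b else 0)
  let sE : ℕ → ℝ := fun n => ∑ a ∈ Finset.range (n + 1), ∑ b ∈ Finset.range (n + 1),
        (if 2 * a + 2 * b ≤ n then vou F 2 a * vou F 2 b else 0)
  -- the exact formula
  have hex : ∀ n : ℕ, ∑ᶠ f ∈ {f : Polynomial F | f.Monic ∧ f.natDegree = n},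
            ((omegak F 1 f : ℝ) - Real.log n) ^ 2 = (Fintype.card F : ℝ) ^ n *
      ((sC n - 2 * sD n + sE n) - (sB n - 2 * sD3 n + sD4 n) +
        (1 - 2 * Real.log n) * (sA n - sB n) + Real.log n ^ 2) := by
    intro n
    rw [vo_exact F n (Real.log n)]
    have h1 : ∑ a ∈ Finset.range (n + 1), ∑ b ∈ Finset.range (n + 1),
          (piq F a : ℝ) * (piq F b : ℝ) * voh F n a b = sC n - 2 * sD n + sE n := by
      simp only [vo_pair, Finset.sum_add_distrib, Finset.sum_sub_distrib]
      have : ∑ a ∈ Finset.range (n + 1), ∑ b ∈ Finset.range (n + 1),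
        (if 2 * b + a ≤ n then vou F 2 b * vou F 1 a else 0) = sD n := Finset.sum_comm
      rw [this]
      simp only [sC, sD, sE]; ring
    have h2 : ∑ r ∈ Finset.range (n + 1), (piq F r : ℝ) * voh F n r r =
        sB n - 2 * sD3 n + sD4 n := by
      simp only [vo_diag, Finset.sum_add_distrib, Finset.sum_sub_distrib, ← Finset.mul_sum]
      rfl
    have h3 : ∑ r ∈ Finset.range (n + 1), (piq F r : ℝ) * voe F n r = sA n - sB n := by
      rw [Finset.sum_congr rfl fun r hr => vo_single F n r hr, Finset.sum_sub_distrib]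
    rw [h1, h2, h3]
  -- error terms
  have hone : ∀ m, 2 ≤ m → ∀ k, 1 ≤ k → (fun n : ℕ => (∑ a ∈ Finset.range (n + 1),
      if k * a ≤ n then vou F m a else 0) - ∑' r, vou F m r) =O[atTop] fun n : ℕ => (1 / n : ℝ) :=
    fun m hm k hk => vo_bigO (vo_tail _ (vo_u_summable F m hm) k hk)
  have hB : (fun n => sB n - L2) =O[atTop] fun n : ℕ => (1 / n : ℝ) := by
    rw [hL2]; exact hone 2 le_rfl 2 (by norm_num)
  have hD3 : (fun n => sD3 n - L3) =O[atTop] fun n : ℕ => (1 / n : ℝ) := by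
    rw [hL3]; exact hone 3 (by norm_num) 3 (by norm_num)
  have hD4 : (fun n => sD4 n - L4) =O[atTop] fun n : ℕ => (1 / n : ℝ) := by
    rw [hL4]; exact hone 4 (by norm_num) 4 (by norm_num)
  have hdrop : ∀ v : ℕ → ℝ, ∀ n : ℕ, (∑ a ∈ Finset.range (n + 1), if 1 * a ≤ n then v a else 0) =
      ∑ a ∈ Finset.range (n + 1), v a := by
    intro v n
    refine Finset.sum_congr rfl fun a ha => ?_
    rw [Finset.mem_range] at ha
    rw [if_pos (by omega)]
  have hU : (fun n => sU n - L2) =O[atTop] fun n : ℕ => (1 / n : ℝ) := by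
    rw [hL2]
    have := hone 2 le_rfl 1 le_rfl
    simp only [hdrop] at this
    exact this
  have hA : (fun n : ℕ => sA n - Real.log n - A) =O[atTop] fun n : ℕ => (1 / n : ℝ) := by
    have h1 := vo_bigO (vo_tail _ (vo_eps_summable F) 1 le_rfl)
    simp only [hdrop] at h1
    refine (h1.add (vo_bigO vo_harm)).congr_left fun n => ?_
    rw [hA1, Finset.sum_sub_distrib]; ring
  have hC := vo_bigO (vo_C_est _ (vo_eps_summable F) (vo_p_le F))
  have hD := vo_bigO (vo_D_est _ _ (vo_u_summable F 2 le_rfl) (vo_p_le F))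
  have hE := vo_bigO (vo_E_est _ (vo_u_summable F 2 le_rfl) (vo_u_zero F 2))
  change (fun n => sC n - (sA n ^ 2 - π ^ 2 / 6)) =O[atTop] _ at hC
  change (fun n => sD n - sU n * sA n) =O[atTop] _ at hD
  change (fun n => sE n - sU n * sU n) =O[atTop] _ at hE
  have hlog : ∀ᶠ n : ℕ in atTop, 1 ≤ Real.log n :=
    (Real.tendsto_log_atTop.comp tendsto_natCast_atTop_atTop).eventually_ge_atTop 1
  have hg : (fun n : ℕ => (1 / n : ℝ)) =O[atTop] fun n : ℕ => Real.log n / n := by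
    refine IsBigO.of_bound 1 ?_
    filter_upwards [hlog] with n hn
    rw [one_mul, norm_div, norm_div, Real.norm_eq_abs, Real.norm_eq_abs, abs_one]
    refine div_le_div_of_nonneg_right ?_ (abs_nonneg _)
    exact hn.trans (le_abs_self _)
  have hone' : (fun n : ℕ => (1 / n : ℝ)) =O[atTop] fun _ : ℕ => (1 : ℝ) :=
    tendsto_one_div_atTop_nhds_zero_nat.isBigO_one ℝ
  have hmul : ∀ {f g : ℕ → ℝ}, f =O[atTop] (fun n : ℕ => (1 / n : ℝ)) →
      g =O[atTop] (fun n : ℕ => (1 / n : ℝ)) →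
      (fun n => f n * g n) =O[atTop] (fun n : ℕ => (1 / n : ℝ)) := by
    intro f g hf hg
    simpa using hf.mul (hg.trans hone')
  have hlogmul : ∀ {f : ℕ → ℝ}, f =O[atTop] (fun n : ℕ => (1 / n : ℝ)) →
      (fun n : ℕ => Real.log n * f n) =O[atTop] (fun n : ℕ => Real.log n / n) := by
    intro f hf
    refine ((isBigO_refl (fun n : ℕ => Real.log n) atTop).mul hf).congr_right fun n => ?_
    ring
  -- combine
  have herr : (fun n : ℕ => ((sC n - 2 * sD n + sE n) - (sB n - 2 * sD3 n + sD4 n) +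
        (1 - 2 * Real.log n) * (sA n - sB n) + Real.log n ^ 2) - (Real.log n +
        ((A - 2 * L2) * (A + 1) - Real.pi ^ 2 / 6 + L2 ^ 2 + 2 * L3 - L4)))
        =O[atTop] (fun n : ℕ => Real.log n / n) := by
    have t1 := (((((hC.sub (hD.const_mul_left 2)).add hE).sub (hB.const_mul_left 2)).add
      (hD3.const_mul_left 2)).sub hD4)
    have t2 := ((hA.const_mul_left (1 + 2 * A - 2 * L2)).add (hmul hA hA)).sub
      ((hmul hU hA).const_mul_left 2)
    have t3 := (hU.const_mul_left (2 * L2 - 2 * A)).add (hmul hU hU)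
    have t4 := (hlogmul hB).const_mul_left 2
    have t5 := (hlogmul hU).const_mul_left 2
    refine ((((t1.add t2).add t3).trans hg).add (t4.sub t5)).congr_left fun n => ?_
    ring
  refine ((isBigO_refl (fun n : ℕ => (Fintype.card F : ℝ) ^ n) atTop).mul herr).congr
    (fun n => ?_) (fun n => ?_)
  · rw [hex n]; ring
  · ring
end

section
/- Let F_q be a finite field with q elements, ω₁(f) the number of monic irreducible factors of f with multiplicity exactly 1, and ε' ∈ (0, 1/2). Then the number of monic polynomials f of degree n with |ω₁(f) - log n| ≥ (log n)^{1/2 + ε'} is o(q^n) as n → ∞; in particular ω₁ has normal order log(deg f). -/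
open Filter Asymptotics Real Polynomial

/-- the finset of monic polynomials of degree `n` -/
theorem monic_finite (F : Type*) [Field F] [Fintype F] (n : ℕ) :
    Finite {f : Polynomial F // f.Monic ∧ f.natDegree = n} :=
  Finite.of_equiv _ ((monicEquivDegreeLT n).trans (degreeLTEquiv F n).toEquiv).symm

theorem monic_card (F : Type*) [Field F] [Fintype F] (n : ℕ) :
    Nat.card {f : Polynomial F // f.Monic ∧ f.natDegree = n} = Fintype.card F ^ n := by
  rw [Nat.card_congr ((monicEquivDegreeLT n).trans (degreeLTEquiv F n).toEquiv)]
  simp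

theorem monic_set_finite (F : Type*) [Field F] [Fintype F] (n : ℕ) :
    {f : Polynomial F | f.Monic ∧ f.natDegree = n}.Finite :=
  Set.finite_coe_iff.mp (monic_finite F n)

noncomputable def Mn (F : Type*) [Field F] [Fintype F] (n : ℕ) : Finset (Polynomial F) :=
  (monic_set_finite F n).toFinset

theorem mem_Mn {F : Type*} [Field F] [Fintype F] {n : ℕ} {f : Polynomial F} :
    f ∈ Mn F n ↔ f.Monic ∧ f.natDegree = n := by
  simp [Mn]

theorem card_Mn (F : Type*) [Field F] [Fintype F] (n : ℕ) :
    (Mn F n).card = Fintype.card F ^ n := by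
  rw [← monic_card F n, Mn, ← Set.ncard_eq_toFinset_card _ (monic_set_finite F n)]; rfl

open Classical in
theorem count_dvd {F : Type*} [Field F] [Fintype F] (n : ℕ) {g : Polynomial F} (hg : g.Monic) :
    (∑ f ∈ Mn F n, if g ∣ f then (1 : ℝ) else 0) =
      if g.natDegree ≤ n then (Fintype.card F : ℝ) ^ n / (Fintype.card F : ℝ) ^ g.natDegree else 0 := by
  rw [← Finset.sum_filter]
  split_ifs with h
  · have hcard : ((Mn F n).filter (fun f => g ∣ f)) =
        (Mn F (n - g.natDegree)).image (fun h => g * h) := by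
      ext f
      simp only [Finset.mem_filter, mem_Mn, Finset.mem_image]
      constructor
      · rintro ⟨⟨h1, h2⟩, k, rfl⟩
        have hk : k.Monic := hg.of_mul_monic_left h1
        rw [hg.natDegree_mul hk] at h2
        exact ⟨k, ⟨hk, by omega⟩, rfl⟩
      · rintro ⟨k, ⟨h1, h2⟩, rfl⟩
        exact ⟨⟨hg.mul h1, by rw [hg.natDegree_mul h1]; omega⟩, dvd_mul_right _ _⟩
    rw [hcard, Finset.sum_const, Finset.card_image_of_injective _
      (mul_right_injective₀ hg.ne_zero), card_Mn]
    have hq : (Fintype.card F : ℝ) ≠ 0 := by exact_mod_cast Fintype.card_ne_zero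
    rw [eq_div_iff (pow_ne_zero _ hq)]
    push_cast
    rw [nsmul_eq_mul, mul_one]
    push_cast
    rw [← pow_add]
    congr 1
    omega
  · apply Finset.sum_eq_zero_iff_of_nonneg (fun _ _ => zero_le_one) |>.mpr
    intro f hf
    simp only [Finset.mem_filter, mem_Mn] at hf
    exact absurd (natDegree_le_of_dvd hf.2 hf.1.1.ne_zero) (by omega)

open Classical in
theorem count_dvd_le {F : Type*} [Field F] [Fintype F] (n : ℕ) {g : Polynomial F} (hg : g.Monic) :
    (∑ f ∈ Mn F n, if g ∣ f then (1 : ℝ) else 0) ≤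
      (Fintype.card F : ℝ) ^ n / (Fintype.card F : ℝ) ^ g.natDegree := by
  rw [count_dvd n hg]
  split_ifs
  · exact le_rfl
  · positivity

open Classical in
noncomputable def Pr (F : Type*) [Field F] [Fintype F] (r : ℕ) : Finset (Polynomial F) :=
  (Mn F r).filter Irreducible

open Classical in
noncomputable def PP (F : Type*) [Field F] [Fintype F] (n : ℕ) : Finset (Polynomial F) :=
  (Finset.Icc 1 n).biUnion (Pr F)

theorem mem_Pr {F : Type*} [Field F] [Fintype F] {n : ℕ} {f : Polynomial F} :
    f ∈ Pr F n ↔ f.Monic ∧ f.natDegree = n ∧ Irreducible f := by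
  simp [Pr, mem_Mn, and_assoc]

theorem mem_PP {F : Type*} [Field F] [Fintype F] {n : ℕ} {f : Polynomial F} :
    f ∈ PP F n ↔ f.Monic ∧ Irreducible f ∧ f.natDegree ≤ n := by
  simp only [PP, Finset.mem_biUnion, mem_Pr, Finset.mem_Icc]
  constructor
  · rintro ⟨a, h, h1, rfl, h2⟩
    exact ⟨h1, h2, h.2⟩
  · rintro ⟨h1, h2, h3⟩
    exact ⟨_, ⟨h2.natDegree_pos, h3⟩, h1, rfl, h2⟩

theorem sum_PP {F : Type*} [Field F] [Fintype F] (n : ℕ) (h : ℕ → ℝ) :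
    ∑ l ∈ PP F n, h l.natDegree = ∑ r ∈ Finset.Icc 1 n, ((Pr F r).card : ℝ) * h r := by
  classical
  unfold PP
  rw [Finset.sum_biUnion]
  · apply Finset.sum_congr rfl
    intro r _
    rw [Finset.sum_congr rfl (g := fun _ => h r), Finset.sum_const, nsmul_eq_mul]
    intro l hl
    rw [(mem_Pr.mp hl).2.1]
  · intro a _ b _ hab
    rw [Function.onFun, Finset.disjoint_left]
    intro f h1 h2
    exact hab ((mem_Pr.mp h1).2.1.symm.trans (mem_Pr.mp h2).2.1)

open Classical in
theorem degree_formula {F : Type*} [Field F] [Fintype F] {n : ℕ} {f : Polynomial F}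
    (hf : f ∈ Mn F n) :
    (n : ℝ) = ∑ l ∈ PP F n, ∑ k ∈ Finset.Icc 1 n,
      (l.natDegree : ℝ) * (if l ^ k ∣ f then (1 : ℝ) else 0) := by
  obtain ⟨hm, hd⟩ := mem_Mn.mp hf
  have hf0 := hm.ne_zero
  set S := UniqueFactorizationMonoid.normalizedFactors f with hS
  have hprod : S.prod = f := by
    have := UniqueFactorizationMonoid.prod_normalizedFactors_eq hf0
    rw [← hS] at this
    rw [this, hm.normalize_eq_self]
  have hmem : ∀ l ∈ S, l.Monic ∧ Irreducible l ∧ l.natDegree ≤ n := by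
    intro l hl
    have hi := UniqueFactorizationMonoid.irreducible_of_normalized_factor l hl
    have hn := UniqueFactorizationMonoid.normalize_normalized_factor l hl
    refine ⟨?_, hi, ?_⟩
    · rw [← hn]; exact Polynomial.monic_normalize hi.ne_zero
    · rw [← hd]; exact natDegree_le_of_dvd (UniqueFactorizationMonoid.dvd_of_mem_normalizedFactors hl) hf0
  have hsub : S.toFinset ⊆ PP F n := by
    intro l hl
    rw [Multiset.mem_toFinset] at hl
    exact mem_PP.mpr (hmem l hl)
  have h1 : n = ∑ l ∈ PP F n, S.count l * l.natDegree := by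
    rw [← hd]
    conv_lhs => rw [← hprod]
    rw [natDegree_multiset_prod_of_monic _ (fun l hl => (hmem l hl).1),
      Finset.sum_multiset_map_count]
    simp only [smul_eq_mul]
    rw [hd]
    apply Finset.sum_subset hsub
    intro x _ hx
    rw [Multiset.mem_toFinset] at hx
    simp [Multiset.count_eq_zero_of_notMem hx]
  have h2 : ∀ l ∈ PP F n, ((Finset.Icc 1 n).filter (fun k => l ^ k ∣ f)) =
      Finset.Icc 1 (S.count l) := by
    intro l hl
    obtain ⟨hl1, hl2, hl3⟩ := mem_PP.mp hl
    have key : ∀ k, l ^ k ∣ f ↔ k ≤ S.count l := by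
      intro k
      rw [pow_dvd_iff_le_emultiplicity,
        UniqueFactorizationMonoid.emultiplicity_eq_count_normalizedFactors hl2 hf0,
        hl1.normalize_eq_self]
      exact Nat.cast_le
    ext k
    simp only [Finset.mem_filter, Finset.mem_Icc, key]
    constructor
    · rintro ⟨⟨a, b⟩, c⟩; exact ⟨a, c⟩
    · rintro ⟨a, b⟩
      refine ⟨⟨a, ?_⟩, b⟩
      have := natDegree_le_of_dvd ((key k).mpr b) hf0
      rw [natDegree_pow, hd] at this
      have := hl2.natDegree_pos
      nlinarith
  calc (n : ℝ) = ∑ l ∈ PP F n, (S.count l : ℝ) * l.natDegree := by exact_mod_cast h1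
    _ = _ := by
      apply Finset.sum_congr rfl
      intro l hl
      rw [← Finset.mul_sum, ← Finset.sum_filter, h2 l hl]
      simp [mul_comm]

theorem two_le_q (F : Type*) [Field F] [Fintype F] : (2 : ℝ) ≤ (Fintype.card F : ℝ) := by
  exact_mod_cast Fintype.one_lt_card

theorem mult_reindex (n r : ℕ) (hr : 1 ≤ r) (g : ℕ → ℝ) :
    ∑ k ∈ Finset.Icc 1 n, (if r * k ≤ n then g (r * k) else 0) =
      ∑ m ∈ Finset.Icc 1 n, if r ∣ m then g m else 0 := by
  rw [← Finset.sum_filter, ← Finset.sum_filter]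
  apply Finset.sum_nbij' (fun k => r * k) (fun m => m / r)
  · intro k hk
    simp only [Finset.mem_filter, Finset.mem_Icc] at hk ⊢
    refine ⟨⟨?_, hk.2⟩, dvd_mul_right _ _⟩
    nlinarith
  · intro m hm
    simp only [Finset.mem_filter, Finset.mem_Icc] at hm ⊢
    obtain ⟨⟨h1, h2⟩, k, rfl⟩ := hm
    rw [Nat.mul_div_cancel_left _ hr]
    have : 1 ≤ k := by
      rcases Nat.eq_zero_or_pos k with h | h
      · subst h; simp at h1
      · exact h
    refine ⟨⟨this, ?_⟩, h2⟩
    nlinarith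
  · intro k _
    exact Nat.mul_div_cancel_left _ hr
  · intro m hm
    simp only [Finset.mem_filter] at hm
    exact Nat.mul_div_cancel' hm.2
  · intro _ _; rfl

/-- cumulative form of the prime polynomial theorem -/
theorem cumulative (F : Type*) [Field F] [Fintype F] (n : ℕ) :
    (n : ℝ) = ∑ m ∈ Finset.Icc 1 n, (∑ r ∈ m.divisors, ((Pr F r).card : ℝ) * r) /
      (Fintype.card F : ℝ) ^ m := by
  classical
  have hq := two_le_q F
  set q : ℝ := (Fintype.card F : ℝ) with hqdef
  have hqn : (0 : ℝ) < q ^ n := by positivity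
  have h1 : (n : ℝ) * q ^ n = ∑ l ∈ PP F n, ∑ k ∈ Finset.Icc 1 n,
      (l.natDegree : ℝ) * (if l.natDegree * k ≤ n then q ^ n / q ^ (l.natDegree * k) else 0) := by
    calc (n : ℝ) * q ^ n = ∑ f ∈ Mn F n, (n : ℝ) := by
          rw [Finset.sum_const, card_Mn, nsmul_eq_mul]; push_cast; ring
      _ = ∑ f ∈ Mn F n, ∑ l ∈ PP F n, ∑ k ∈ Finset.Icc 1 n,
            (l.natDegree : ℝ) * (if l ^ k ∣ f then (1 : ℝ) else 0) :=
          Finset.sum_congr rfl (fun f hf => degree_formula hf)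
      _ = _ := by
          rw [Finset.sum_comm]
          apply Finset.sum_congr rfl
          intro l hl
          rw [Finset.sum_comm]
          apply Finset.sum_congr rfl
          intro k _
          have hm := (mem_PP.mp hl).1
          rw [← Finset.mul_sum, count_dvd n (hm.pow k), hm.natDegree_pow, mul_comm k]
  have h2 : ∀ l ∈ PP F n, ∑ k ∈ Finset.Icc 1 n,
      (l.natDegree : ℝ) * (if l.natDegree * k ≤ n then q ^ n / q ^ (l.natDegree * k) else 0)
      = (fun r : ℕ => (r : ℝ) * ∑ m ∈ Finset.Icc 1 n, if r ∣ m then q ^ n / q ^ m else 0)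
        l.natDegree := by
    intro l hl
    have := (mem_PP.mp hl).2.1.natDegree_pos
    rw [← Finset.mul_sum, mult_reindex n l.natDegree this (fun m => q ^ n / q ^ m)]
  rw [Finset.sum_congr rfl h2, sum_PP n (fun r : ℕ => (r : ℝ) * ∑ m ∈ Finset.Icc 1 n,
    if r ∣ m then q ^ n / q ^ m else 0)] at h1
  have h3 : ∑ r ∈ Finset.Icc 1 n, ((Pr F r).card : ℝ) * ((r : ℝ) * ∑ m ∈ Finset.Icc 1 n,
      if r ∣ m then q ^ n / q ^ m else 0) = q ^ n * ∑ m ∈ Finset.Icc 1 n,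
      (∑ r ∈ m.divisors, ((Pr F r).card : ℝ) * r) / q ^ m := by
    simp_rw [← mul_assoc, Finset.mul_sum]
    rw [Finset.sum_comm]
    apply Finset.sum_congr rfl
    intro m hm
    rw [Finset.mem_Icc] at hm
    have hdiv : m.divisors = (Finset.Icc 1 n).filter (fun r => r ∣ m) := by
      ext r
      simp only [Nat.mem_divisors, Finset.mem_filter, Finset.mem_Icc]
      constructor
      · rintro ⟨h, _⟩
        exact ⟨⟨Nat.pos_of_dvd_of_pos h (by omega), (Nat.le_of_dvd (by omega) h).trans hm.2⟩, h⟩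
      · rintro ⟨_, h⟩
        exact ⟨h, by omega⟩
    rw [hdiv, Finset.sum_filter, Finset.sum_div, Finset.mul_sum]
    apply Finset.sum_congr rfl
    intro r _
    split_ifs
    · ring
    · simp
  rw [h3] at h1
  have : q ^ n * (n : ℝ) = q ^ n * ∑ m ∈ Finset.Icc 1 n,
      (∑ r ∈ m.divisors, ((Pr F r).card : ℝ) * r) / q ^ m := by rw [← h1]; ring
  exact mul_left_cancel₀ hqn.ne' this

theorem prime_formula (F : Type*) [Field F] [Fintype F] {m : ℕ} (hm : 1 ≤ m) :
    ∑ r ∈ m.divisors, ((Pr F r).card : ℝ) * r = (Fintype.card F : ℝ) ^ m := by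
  have hq := two_le_q F
  obtain ⟨n, rfl⟩ : ∃ n, m = n + 1 := ⟨m - 1, by omega⟩
  have h1 := cumulative F (n + 1)
  rw [Finset.sum_Icc_succ_top (by omega), ← cumulative F n] at h1
  push_cast at h1
  have h2 := (add_left_cancel h1).symm
  rw [div_eq_one_iff_eq (by positivity)] at h2
  exact h2

theorem prime_upper (F : Type*) [Field F] [Fintype F] {r : ℕ} (hr : 1 ≤ r) :
    ((Pr F r).card : ℝ) * r ≤ (Fintype.card F : ℝ) ^ r := by
  rw [← prime_formula F hr]
  exact Finset.single_le_sum (f := fun r : ℕ => ((Pr F r).card : ℝ) * r)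
    (fun _ _ => by positivity) (Nat.mem_divisors_self r (by omega))

theorem geom_aux (q : ℝ) (hq : 2 ≤ q) (k : ℕ) : ∑ d ∈ Finset.range (k + 1), q ^ d ≤ 2 * q ^ k := by
  induction k with
  | zero => simp
  | succ k ih =>
    rw [Finset.sum_range_succ]
    have : 0 < q ^ k := by positivity
    have h2 : q ^ (k + 1) = q ^ k * q := pow_succ _ _
    nlinarith

theorem prime_lower (F : Type*) [Field F] [Fintype F] {r : ℕ} (hr : 1 ≤ r) :
    (Fintype.card F : ℝ) ^ r - 2 * (Fintype.card F : ℝ) ^ (r / 2) ≤ ((Pr F r).card : ℝ) * r := by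
  have hq := two_le_q F
  have h := prime_formula F hr
  rw [← Nat.insert_self_properDivisors (by omega : r ≠ 0),
    Finset.sum_insert Nat.self_notMem_properDivisors] at h
  have h2 : ∑ d ∈ r.properDivisors, ((Pr F d).card : ℝ) * d ≤
      2 * (Fintype.card F : ℝ) ^ (r / 2) := by
    refine le_trans ?_ (geom_aux _ hq (r / 2))
    calc ∑ d ∈ r.properDivisors, ((Pr F d).card : ℝ) * d
        ≤ ∑ d ∈ r.properDivisors, (Fintype.card F : ℝ) ^ d := by
          apply Finset.sum_le_sum
          intro d hd
          exact prime_upper F (Nat.pos_of_mem_properDivisors hd)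
      _ ≤ _ := by
          apply Finset.sum_le_sum_of_subset_of_nonneg
          · intro d hd
            rw [Nat.mem_properDivisors] at hd
            obtain ⟨⟨k, hk⟩, h2⟩ := hd
            rw [Finset.mem_range]
            have : 2 ≤ k := by
              by_contra hc
              have : k = 0 ∨ k = 1 := by omega
              rcases this with rfl | rfl <;> omega
            have : d * 2 ≤ r := by rw [hk]; exact Nat.mul_le_mul_left _ this
            omega
          · intros; positivity
  linarith

/-- the mean: `Σ_{r ≤ m} π(r) / q^r` -/
noncomputable def MM (F : Type*) [Field F] [Fintype F] (m : ℕ) : ℝ :=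
  ∑ r ∈ Finset.Icc 1 m, ((Pr F r).card : ℝ) * (1 / (Fintype.card F : ℝ) ^ r)

theorem MM_upper (F : Type*) [Field F] [Fintype F] (m : ℕ) : MM F m ≤ harmonic m := by
  have hq := two_le_q F
  rw [harmonic_eq_sum_Icc, MM]
  push_cast
  apply Finset.sum_le_sum
  intro r hr
  have hr1 := (Finset.mem_Icc.mp hr).1
  have := prime_upper F hr1
  have hr0 : (0 : ℝ) < r := by exact_mod_cast hr1
  rw [mul_one_div, inv_eq_one_div, div_le_div_iff₀ (by positivity) hr0]
  linarith

theorem half_aux (q : ℝ) (hq : 2 ≤ q) (r : ℕ) : q ^ (r / 2) / q ^ r ≤ (3 / 4 : ℝ) ^ r := by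
  have e : q ^ r = q ^ (r / 2) * q ^ (r - r / 2) := by rw [← pow_add]; congr 1; omega
  rw [e, div_mul_eq_div_div, div_self (by positivity), one_div, ← inv_pow]
  have hi : q⁻¹ ≤ 1 / 2 := by rw [inv_eq_one_div]; exact one_div_le_one_div_of_le (by norm_num) hq
  have h1 : q⁻¹ ^ (r - r / 2) ≤ (1 / 2 : ℝ) ^ (r - r / 2) :=
    pow_le_pow_left₀ (by positivity) hi _
  refine h1.trans ?_
  have h2 : (1 / 2 : ℝ) ^ (r - r / 2) ≤ ((3 / 4 : ℝ) ^ 2) ^ (r - r / 2) * 1 := by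
    rw [mul_one]; exact pow_le_pow_left₀ (by norm_num) (by norm_num) _
  rcases Nat.even_or_odd' r with ⟨s, hs | hs⟩
  · have : r - r / 2 = s := by omega
    rw [this, hs, pow_mul]
    exact pow_le_pow_left₀ (by norm_num) (by norm_num) _
  · have : r - r / 2 = s + 1 := by omega
    rw [this, hs, pow_succ, pow_succ, pow_mul]
    apply mul_le_mul _ (by norm_num) (by norm_num) (by positivity)
    exact pow_le_pow_left₀ (by norm_num) (by norm_num) _

theorem MM_lower (F : Type*) [Field F] [Fintype F] (m : ℕ) : (harmonic m : ℝ) - 8 ≤ MM F m := by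
  have hq := two_le_q F
  have h1 : ∑ r ∈ Finset.Icc 1 m, (3 / 4 : ℝ) ^ r ≤ 4 := by
    have hs : Summable (fun r : ℕ => (3 / 4 : ℝ) ^ r) :=
      summable_geometric_of_lt_one (by norm_num) (by norm_num)
    refine (hs.sum_le_tsum _ (fun _ _ => by positivity)).trans ?_
    rw [tsum_geometric_of_lt_one (by norm_num) (by norm_num)]
    norm_num
  have h2 : (harmonic m : ℝ) - 2 * ∑ r ∈ Finset.Icc 1 m, (3 / 4 : ℝ) ^ r ≤ MM F m := by
    rw [harmonic_eq_sum_Icc, MM]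
    push_cast
    rw [Finset.mul_sum, ← Finset.sum_sub_distrib]
    apply Finset.sum_le_sum
    intro r hr
    have hr1 := (Finset.mem_Icc.mp hr).1
    have h3 := prime_lower F hr1
    have hr0 : (1 : ℝ) ≤ r := by exact_mod_cast hr1
    have h4 := half_aux _ hq r
    set q : ℝ := (Fintype.card F : ℝ)
    have hp : 0 < q ^ r := by positivity
    rw [div_le_iff₀ hp] at h4
    set u := (3 / 4 : ℝ) ^ r
    have hu : 0 ≤ u := by positivity
    have h5 : q ^ r - 2 * (u * q ^ r) * r ≤ ((Pr F r).card : ℝ) * r := by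
      have : u * q ^ r * 1 ≤ u * q ^ r * r := mul_le_mul_of_nonneg_left hr0 (by positivity)
      linarith
    rw [mul_one_div, le_div_iff₀ hp]
    have h6 : ((r : ℝ)⁻¹ - 2 * u) * q ^ r = (q ^ r - 2 * (u * q ^ r) * r) / r := by
      field_simp
    rw [h6, div_le_iff₀ (by linarith)]
    exact h5
  linarith

theorem MM_half_lower (F : Type*) [Field F] [Fintype F] {n : ℕ} (hn : 1 ≤ n) :
    Real.log n - 9 ≤ MM F (n / 2) := by
  have h1 := MM_lower F (n / 2)
  have h2 := log_add_one_le_harmonic (n / 2)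
  have h3 : Real.log n ≤ Real.log (2 * ((n / 2 : ℕ) + 1 : ℕ)) := by
    apply Real.log_le_log (by exact_mod_cast hn)
    norm_cast
    omega
  rw [Real.log_mul (by norm_num) (by positivity)] at h3
  have := Real.log_two_lt_d9
  linarith

theorem MM_le (F : Type*) [Field F] [Fintype F] {m n : ℕ} (hn : 1 ≤ n) (hm : m ≤ n) :
    MM F m ≤ 1 + Real.log n := by
  have h1 := MM_upper F m
  have h2 := harmonic_le_one_add_log m
  refine (h1.trans h2).trans ?_
  rcases Nat.eq_zero_or_pos m with rfl | h
  · simp only [Nat.cast_zero, Real.log_zero]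
    have := Real.log_natCast_nonneg n
    linarith
  · have := Real.log_le_log (by exact_mod_cast h) (show (m : ℝ) ≤ n by exact_mod_cast hm)
    linarith

open Classical in
/-- number of primes of degree at most `m` dividing `f` -/
noncomputable def omT (F : Type*) [Field F] [Fintype F] (m : ℕ) (f : Polynomial F) : ℝ :=
  ∑ l ∈ PP F m, if l ∣ f then (1 : ℝ) else 0

open Classical in
/-- number of primes of degree at most `m` whose square divides `f` -/
noncomputable def omS (F : Type*) [Field F] [Fintype F] (m : ℕ) (f : Polynomial F) : ℝ :=
  ∑ l ∈ PP F m, if l ^ 2 ∣ f then (1 : ℝ) else 0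

theorem sum_omT (F : Type*) [Field F] [Fintype F] {m n : ℕ} (hm : m ≤ n) :
    ∑ f ∈ Mn F n, omT F m f = (Fintype.card F : ℝ) ^ n * MM F m := by
  classical
  unfold omT
  rw [Finset.sum_comm, MM, ← sum_PP m (fun r => 1 / (Fintype.card F : ℝ) ^ r), Finset.mul_sum]
  apply Finset.sum_congr rfl
  intro l hl
  obtain ⟨h1, h2, h3⟩ := mem_PP.mp hl
  rw [count_dvd n h1, if_pos (h3.trans hm)]
  ring

theorem sum_omS (F : Type*) [Field F] [Fintype F] (n : ℕ) :
    ∑ f ∈ Mn F n, omS F n f ≤ (Fintype.card F : ℝ) ^ n * 2 := by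
  classical
  have hq := two_le_q F
  unfold omS
  rw [Finset.sum_comm]
  set q : ℝ := (Fintype.card F : ℝ) with hqd
  calc ∑ l ∈ PP F n, ∑ f ∈ Mn F n, (if l ^ 2 ∣ f then (1 : ℝ) else 0)
      ≤ ∑ l ∈ PP F n, (fun r : ℕ => q ^ n / q ^ (2 * r)) l.natDegree := by
        apply Finset.sum_le_sum
        intro l hl
        obtain ⟨h1, h2, h3⟩ := mem_PP.mp hl
        have := count_dvd_le n (h1.pow 2)
        rwa [h1.natDegree_pow] at this
    _ = ∑ r ∈ Finset.Icc 1 n, ((Pr F r).card : ℝ) * (q ^ n / q ^ (2 * r)) :=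
        sum_PP n (fun r : ℕ => q ^ n / q ^ (2 * r))
    _ ≤ ∑ r ∈ Finset.Icc 1 n, q ^ n * (1 / 2 : ℝ) ^ r := by
        apply Finset.sum_le_sum
        intro r hr
        have hr1 := (Finset.mem_Icc.mp hr).1
        have h3 := prime_upper F hr1
        have hr0 : (1 : ℝ) ≤ r := by exact_mod_cast hr1
        have h4 : ((Pr F r).card : ℝ) ≤ q ^ r := by
          have : ((Pr F r).card : ℝ) * 1 ≤ ((Pr F r).card : ℝ) * r :=
            mul_le_mul_of_nonneg_left hr0 (by positivity)
          linarith
        have h5 : (q ^ r)⁻¹ ≤ (1 / 2 : ℝ) ^ r := by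
          rw [one_div, inv_pow]
          exact inv_anti₀ (by positivity) (pow_le_pow_left₀ (by norm_num) hq _)
        calc ((Pr F r).card : ℝ) * (q ^ n / q ^ (2 * r)) ≤ q ^ r * (q ^ n / q ^ (2 * r)) :=
              mul_le_mul_of_nonneg_right h4 (by positivity)
          _ = q ^ n * (q ^ r)⁻¹ := by
              rw [two_mul, pow_add]; field_simp
          _ ≤ _ := mul_le_mul_of_nonneg_left h5 (by positivity)
    _ ≤ _ := by
        rw [← Finset.mul_sum]
        apply mul_le_mul_of_nonneg_left _ (by positivity)
        have hs : Summable (fun r : ℕ => (1 / 2 : ℝ) ^ r) := summable_geometric_two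
        refine (hs.sum_le_tsum _ (fun _ _ => by positivity)).trans ?_
        rw [tsum_geometric_two]

theorem sum_omT_sq (F : Type*) [Field F] [Fintype F] {m n : ℕ} (hm : 2 * m ≤ n) :
    ∑ f ∈ Mn F n, omT F m f ^ 2 ≤ (Fintype.card F : ℝ) ^ n * (MM F m ^ 2 + MM F m) := by
  classical
  have hq := two_le_q F
  have hMM : MM F m = ∑ l ∈ PP F m, 1 / (Fintype.card F : ℝ) ^ l.natDegree := by
    rw [MM, ← sum_PP m (fun r => 1 / (Fintype.card F : ℝ) ^ r)]
  set q : ℝ := (Fintype.card F : ℝ) with hqd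
  have hpt : ∀ l ∈ PP F m, ∀ l' ∈ PP F m, ∑ f ∈ Mn F n,
      ((if l ∣ f then (1 : ℝ) else 0) * (if l' ∣ f then (1 : ℝ) else 0)) ≤
      q ^ n * ((1 / q ^ l.natDegree) * (1 / q ^ l'.natDegree)) +
        (if l = l' then q ^ n * (1 / q ^ l.natDegree) else 0) := by
    intro l hl l' hl'
    obtain ⟨h1, h2, h3⟩ := mem_PP.mp hl
    obtain ⟨h1', h2', h3'⟩ := mem_PP.mp hl'
    by_cases h : l = l'
    · subst h
      rw [if_pos rfl]
      have := count_dvd_le n h1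
      have e : ∑ f ∈ Mn F n, ((if l ∣ f then (1 : ℝ) else 0) * (if l ∣ f then (1 : ℝ) else 0))
          = ∑ f ∈ Mn F n, (if l ∣ f then (1 : ℝ) else 0) := by
        apply Finset.sum_congr rfl
        intro f _
        split_ifs <;> simp
      rw [e]
      have : 0 ≤ q ^ n * ((1 / q ^ l.natDegree) * (1 / q ^ l.natDegree)) := by positivity
      have e2 : q ^ n * (1 / q ^ l.natDegree) = q ^ n / q ^ l.natDegree := by ring
      rw [e2]
      linarith
    · rw [if_neg h, add_zero]
      have hc : IsCoprime l l' := by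
        rw [h2.coprime_iff_not_dvd]
        intro hd
        exact h (eq_of_monic_of_associated h1 h1' (h2.associated_of_dvd h2' hd))
      have e : ∑ f ∈ Mn F n, ((if l ∣ f then (1 : ℝ) else 0) * (if l' ∣ f then (1 : ℝ) else 0))
          = ∑ f ∈ Mn F n, (if l * l' ∣ f then (1 : ℝ) else 0) := by
        apply Finset.sum_congr rfl
        intro f _
        have : l * l' ∣ f ↔ l ∣ f ∧ l' ∣ f :=
          ⟨fun hd => ⟨(dvd_mul_right _ _).trans hd, (dvd_mul_left _ _).trans hd⟩,
            fun hd => hc.mul_dvd hd.1 hd.2⟩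
        simp only [this]
        split_ifs <;> simp_all
      rw [e]
      have := count_dvd_le n (h1.mul h1')
      rw [h1.natDegree_mul h1', pow_add, ← hqd] at this
      refine this.trans (le_of_eq ?_)
      field_simp
  calc ∑ f ∈ Mn F n, omT F m f ^ 2
      = ∑ l ∈ PP F m, ∑ l' ∈ PP F m, ∑ f ∈ Mn F n,
        ((if l ∣ f then (1 : ℝ) else 0) * (if l' ∣ f then (1 : ℝ) else 0)) := by
        simp_rw [omT, sq, Finset.sum_mul_sum]
        rw [Finset.sum_comm]
        apply Finset.sum_congr rfl
        intro l _
        rw [Finset.sum_comm]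
    _ ≤ ∑ l ∈ PP F m, ∑ l' ∈ PP F m,
        (q ^ n * ((1 / q ^ l.natDegree) * (1 / q ^ l'.natDegree)) +
        (if l = l' then q ^ n * (1 / q ^ l.natDegree) else 0)) :=
        Finset.sum_le_sum (fun l hl => Finset.sum_le_sum (fun l' hl' => hpt l hl l' hl'))
    _ = q ^ n * (MM F m ^ 2 + MM F m) := by
        simp_rw [Finset.sum_add_distrib]
        rw [mul_add, sq, hMM, Finset.sum_mul_sum, Finset.mul_sum, Finset.mul_sum]
        congr 1
        · apply Finset.sum_congr rfl
          intro l _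
          rw [Finset.mul_sum]
        · apply Finset.sum_congr rfl
          intro l hl
          rw [Finset.sum_ite_eq, if_pos hl]

theorem variance_bound (F : Type*) [Field F] [Fintype F] {m n : ℕ} (hm : 2 * m ≤ n) :
    ∑ f ∈ Mn F n, (omT F m f - MM F m) ^ 2 ≤ (Fintype.card F : ℝ) ^ n * MM F m := by
  have h1 := sum_omT_sq F hm
  have h2 := sum_omT F (show m ≤ n by omega)
  have e : ∑ f ∈ Mn F n, (omT F m f - MM F m) ^ 2 =
      ∑ f ∈ Mn F n, omT F m f ^ 2 - 2 * MM F m * ∑ f ∈ Mn F n, omT F m f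
        + (Fintype.card F : ℝ) ^ n * MM F m ^ 2 := by
    have : (Fintype.card F : ℝ) ^ n * MM F m ^ 2 = ∑ f ∈ Mn F n, MM F m ^ 2 := by
      rw [Finset.sum_const, card_Mn, nsmul_eq_mul]; push_cast; ring
    rw [this, Finset.mul_sum, ← Finset.sum_sub_distrib, ← Finset.sum_add_distrib]
    apply Finset.sum_congr rfl
    intro f _
    ring
  rw [e, h2]
  linarith

theorem omegak_one (F : Type*) [Field F] [Fintype F] {n : ℕ} {f : Polynomial F}
    (hf : f ∈ Mn F n) : (omegak F 1 f : ℝ) = omT F n f - omS F n f := by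
  classical
  obtain ⟨hm, hd⟩ := mem_Mn.mp hf
  have e : omegak F 1 f = ((PP F n).filter (fun l => l ∣ f ∧ ¬ l ^ 2 ∣ f)).card := by
    unfold omegak
    rw [← Nat.card_eq_finsetCard]
    apply Nat.card_congr
    apply Equiv.subtypeEquivRight
    intro l
    simp only [Finset.mem_filter, mem_PP, pow_one]
    constructor
    · rintro ⟨a, b, c, d⟩
      exact ⟨⟨a, b, hd ▸ natDegree_le_of_dvd c hm.ne_zero⟩, c, d⟩
    · rintro ⟨⟨a, b, _⟩, c, d⟩
      exact ⟨a, b, c, d⟩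
  rw [e, Finset.card_filter, omT, omS, ← Finset.sum_sub_distrib]
  push_cast
  apply Finset.sum_congr rfl
  intro l _
  have : l ^ 2 ∣ f → l ∣ f := fun h => (dvd_pow_self l two_ne_zero).trans h
  split_ifs <;> simp_all

theorem omT_mono (F : Type*) [Field F] [Fintype F] {m n : ℕ} (h : m ≤ n) (f : Polynomial F) :
    omT F m f ≤ omT F n f := by
  classical
  apply Finset.sum_le_sum_of_subset_of_nonneg
  · intro l hl
    obtain ⟨h1, h2, h3⟩ := mem_PP.mp hl
    exact mem_PP.mpr ⟨h1, h2, h3.trans h⟩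
  · intros; split_ifs <;> norm_num

theorem omS_nonneg (F : Type*) [Field F] [Fintype F] (n : ℕ) (f : Polynomial F) :
    0 ≤ omS F n f := by
  classical
  apply Finset.sum_nonneg
  intros; split_ifs <;> norm_num

/-- first absolute moment -/
theorem main_bound (F : Type*) [Field F] [Fintype F] {n : ℕ} (hn : 1 ≤ n) :
    ∑ f ∈ Mn F n, |(omegak F 1 f : ℝ) - Real.log n| ≤
      (Fintype.card F : ℝ) ^ n * (22 + √(1 + Real.log n)) := by
  have hq := two_le_q F
  set M := MM F (n / 2) with hM
  set L := Real.log n with hL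
  have hL0 : 0 ≤ L := Real.log_natCast_nonneg n
  set s := √(1 + L) with hs
  have hs0 : 0 < s := Real.sqrt_pos.mpr (by linarith)
  have hss : s * s = 1 + L := Real.mul_self_sqrt (by linarith)
  have b1 : L - 9 ≤ M := MM_half_lower F hn
  have b2 : M ≤ 1 + L := MM_le F hn (Nat.div_le_self _ _)
  have b3 : MM F n ≤ 1 + L := MM_le F hn le_rfl
  have v := variance_bound F (show 2 * (n / 2) ≤ n by omega)
  have t1 := sum_omT F (le_refl n)
  have t2 := sum_omT F (Nat.div_le_self n 2)
  have t3 := sum_omS F n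
  have pt : ∀ f ∈ Mn F n, |(omegak F 1 f : ℝ) - L| ≤
      (omT F (n / 2) f - M) ^ 2 * (1 / (2 * s)) + (omT F n f - omT F (n / 2) f) + omS F n f
        + (s / 2 + 9) := by
    intro f hf
    rw [omegak_one F hf]
    have m1 := omT_mono F (Nat.div_le_self n 2) f
    have m2 := omS_nonneg F n f
    have m3 : |omT F (n / 2) f - M| ≤ (omT F (n / 2) f - M) ^ 2 * (1 / (2 * s)) + s / 2 := by
      have e : (omT F (n / 2) f - M) ^ 2 * (1 / (2 * s)) + s / 2
          = ((omT F (n / 2) f - M) ^ 2 + s ^ 2) / (2 * s) := by field_simp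
      rw [e, le_div_iff₀ (by positivity), ← sq_abs (omT F (n / 2) f - M)]
      nlinarith [sq_nonneg (|omT F (n / 2) f - M| - s)]
    have m4 := abs_le.mp (le_refl |omT F (n / 2) f - M|)
    rw [abs_le]
    constructor <;> linarith [m4.1, m4.2]
  have hsum := Finset.sum_le_sum pt
  simp only [Finset.sum_add_distrib, Finset.sum_sub_distrib, ← Finset.sum_mul,
    Finset.sum_const, card_Mn, nsmul_eq_mul] at hsum
  rw [t1, t2] at hsum
  push_cast at hsum
  set Q : ℝ := (Fintype.card F : ℝ) ^ n with hQ
  have hQ0 : 0 < Q := by positivity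
  have v2 : (∑ f ∈ Mn F n, (omT F (n / 2) f - M) ^ 2) * (1 / (2 * s)) ≤ Q * (s / 2) := by
    have : (∑ f ∈ Mn F n, (omT F (n / 2) f - M) ^ 2) ≤ Q * (s * s) := by
      rw [hss]
      exact v.trans (mul_le_mul_of_nonneg_left b2 hQ0.le)
    calc _ ≤ Q * (s * s) * (1 / (2 * s)) := mul_le_mul_of_nonneg_right this (by positivity)
      _ = _ := by field_simp
  have v3 : Q * (MM F n - M) ≤ Q * 10 := mul_le_mul_of_nonneg_left (by linarith) hQ0.le
  have v4 : 0 ≤ Q * s := by positivity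
  rw [← hM] at hsum
  nlinarith

/-- Markov -/
theorem markov (F : Type*) [Field F] [Fintype F] {n : ℕ} (hn : 1 ≤ n) (P : Polynomial F → Prop)
    (T : ℝ) (hT : 0 < T)
    (hP : ∀ f ∈ Mn F n, P f → T ≤ |(omegak F 1 f : ℝ) - Real.log n|) :
    (Nat.card {f : Polynomial F // f.Monic ∧ f.natDegree = n ∧ P f} : ℝ) ≤
      ((22 + √(1 + Real.log n)) / T) * (Fintype.card F : ℝ) ^ n := by
  classical
  have e : Nat.card {f : Polynomial F // f.Monic ∧ f.natDegree = n ∧ P f} =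
      ((Mn F n).filter P).card := by
    rw [← Nat.card_eq_finsetCard]
    apply Nat.card_congr
    apply Equiv.subtypeEquivRight
    intro l
    simp [mem_Mn, and_assoc]
  rw [e, div_mul_eq_mul_div, le_div_iff₀ hT]
  calc ((((Mn F n).filter P).card : ℕ) : ℝ) * T = ∑ f ∈ (Mn F n).filter P, T := by
        rw [Finset.sum_const, nsmul_eq_mul]
    _ ≤ ∑ f ∈ (Mn F n).filter P, |(omegak F 1 f : ℝ) - Real.log n| := by
        apply Finset.sum_le_sum
        intro f hf
        rw [Finset.mem_filter] at hf
        exact hP f hf.1 hf.2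
    _ ≤ ∑ f ∈ Mn F n, |(omegak F 1 f : ℝ) - Real.log n| :=
        Finset.sum_le_sum_of_subset_of_nonneg (Finset.filter_subset _ _)
          (fun _ _ _ => abs_nonneg _)
    _ ≤ _ := by
        have := main_bound F hn
        linarith

theorem little_o (F : Type*) [Field F] [Fintype F] (P : ℕ → Polynomial F → Prop)
    (c a : ℝ) (hc : 0 < c) (ha : 1 / 2 < a)
    (hP : ∀ n : ℕ, 2 ≤ n → ∀ f, P n f → c * (Real.log n) ^ a ≤ |(omegak F 1 f : ℝ) - Real.log n|) :
    (fun n : ℕ => (Nat.card {f : Polynomial F // f.Monic ∧ f.natDegree = n ∧ P n f} : ℝ))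
      =o[atTop] (fun n : ℕ => (Fintype.card F : ℝ) ^ n) := by
  have hq := two_le_q F
  have hlog : Tendsto (fun n : ℕ => Real.log n) atTop atTop :=
    Real.tendsto_log_atTop.comp tendsto_natCast_atTop_atTop
  have hlim : Tendsto (fun n : ℕ => 24 / c * (Real.log n) ^ (-(a - 1 / 2))) atTop (nhds 0) := by
    have h1 := (tendsto_rpow_neg_atTop (show 0 < a - 1 / 2 by linarith)).comp hlog
    simpa using h1.const_mul (24 / c)
  rw [isLittleO_iff]
  intro δ hδ
  filter_upwards [eventually_ge_atTop 2, hlog.eventually_ge_atTop 1,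
    hlim.eventually_lt_const hδ] with n hn hL hlt
  have hL0 : 0 < Real.log n := by linarith
  have hT : 0 < c * (Real.log n) ^ a := mul_pos hc (Real.rpow_pos_of_pos hL0 _)
  have h := markov F (show 1 ≤ n by omega) (P n) _ hT (fun f _ hf => hP n hn f hf)
  rw [Real.norm_of_nonneg (by positivity), Real.norm_of_nonneg (by positivity)]
  refine h.trans (mul_le_mul_of_nonneg_right ?_ (by positivity))
  refine le_trans ?_ hlt.le
  have e1 : 22 + √(1 + Real.log n) ≤ 24 * (Real.log n) ^ (1 / 2 : ℝ) := by
    rw [← Real.sqrt_eq_rpow]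
    have s1 : 1 ≤ √(Real.log n) := Real.one_le_sqrt.mpr hL
    have s2 : √(1 + Real.log n) ≤ 2 * √(Real.log n) := by
      rw [Real.sqrt_le_left (by positivity), mul_pow, Real.sq_sqrt hL0.le]
      linarith
    linarith
  rw [div_le_iff₀ hT]
  have e2 : 24 / c * (Real.log n) ^ (-(a - 1 / 2)) * (c * (Real.log n) ^ a) =
      24 * (Real.log n) ^ (1 / 2 : ℝ) := by
    have : (Real.log n) ^ (-(a - 1 / 2)) * (Real.log n) ^ a = (Real.log n) ^ (1 / 2 : ℝ) := by
      rw [← Real.rpow_add hL0]; congr 1; ring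
    rw [← this]
    field_simp
  rw [e2]
  exact e1

/-- The exceptional set for ω₁ is small, and ω₁ has normal order log(deg f). -/
theorem omega_one_normal_order (F : Type*) [Field F] [Fintype F]
    (ε' : ℝ) (hε'0 : 0 < ε') (hε' : ε' < 1 / 2) :
    ((fun n : ℕ =>
        (Nat.card {f : Polynomial F // f.Monic ∧ f.natDegree = n ∧
          (Real.log n) ^ ((1 : ℝ) / 2 + ε') ≤ |(omegak F 1 f : ℝ) - Real.log n|} : ℝ))
      =o[atTop] (fun n : ℕ => (Fintype.card F : ℝ) ^ n)) ∧
    ∀ ε : ℝ, 0 < ε →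
      (fun n : ℕ =>
        (Nat.card {f : Polynomial F // f.Monic ∧ f.natDegree = n ∧
          ¬((1 - ε) * Real.log n ≤ (omegak F 1 f : ℝ) ∧
            (omegak F 1 f : ℝ) ≤ (1 + ε) * Real.log n)} : ℝ))
        =o[atTop] (fun n : ℕ => (Fintype.card F : ℝ) ^ n) := by
  constructor
  · apply little_o F _ 1 (1 / 2 + ε') one_pos (by linarith)
    intro n _ f hf
    rw [one_mul]
    exact hf
  · intro ε hε
    apply little_o F _ ε 1 hε (by norm_num)
    intro n _ f hf
    rw [Real.rpow_one]
    by_contra hcon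
    push Not at hcon
    rw [abs_lt] at hcon
    exact hf ⟨by linarith [hcon.1], by linarith [hcon.2]⟩
end
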